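/- Fix a square root √5 of 5 in K and a fifth root t of 3 in K (so t⁵ = 3). Let γ ∈ K× be such that the plane sextic C_γ : 32X⁶ + γ⁵X(Y⁵ + Z⁵) + 8(12 − γ⁵)X⁴YZ + 2(48 + γ⁵)X²Y²Z² + (32 − γ⁵)Y³Z³ = 0 is smooth and such that for all i, j ∈ {0,1,2,3,4} the triple ((12 − γ⁵)/γ², (48 + γ⁵)/γ⁴, (64 − 2γ⁵)/γ⁶) is different from (−15·ζ₅^(−(3i+j))/t³, −5·ζ₅^(−(i+2j))/t, (10t/9)·ζ₅^(i−3j)). Then Aut(C_γ) ⊂ PGL₃(K) equals the subgroup generated by σ = diag(1, ζ₅, ζ₅⁻¹), τ = [X:Z:Y], and τ′ = the class of the matrix with rows (1, 1, 1), (2, (−1+√5)/2, (−1−√5)/2), (2, (−1−√5)/2, (−1+√5)/2), and Aut(C_γ) is isomorphic to the alternating group A₅ on five letters; in particular |Aut(C_γ)| = 60. -/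

import Mathlib

open MvPolynomial

/-- `GL₃(K)`: the group of invertible `3 × 3` matrices over `K`. -/
abbrev GL3 (K : Type*) [Field K] := (Matrix (Fin 3) (Fin 3) K)ˣ

/-- `PGL₃(K)`: the quotient of `GL₃(K)` by its center (the scalar matrices). -/
abbrev PGL3 (K : Type*) [Field K] := GL3 K ⧸ Subgroup.center (GL3 K)

variable {K : Type*} [Field K]

/-- The substitution `F(X,Y,Z) ↦ F(A·(X,Y,Z)ᵗ)` for a `3 × 3` matrix `A`. -/
noncomputable def matAct (A : Matrix (Fin 3) (Fin 3) K) (F : MvPolynomial (Fin 3) K) :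
    MvPolynomial (Fin 3) K :=
  aeval (fun i => ∑ j, C (A i j) * X j) F

lemma matAct_one (F : MvPolynomial (Fin 3) K) : matAct 1 F = F := by
  unfold matAct
  have h : (fun i => ∑ j, C ((1 : Matrix (Fin 3) (Fin 3) K) i j) * X j)
      = (X : Fin 3 → MvPolynomial (Fin 3) K) := by
    funext i
    rw [Finset.sum_eq_single i]
    · simp
    · intro b _ hb
      simp [Matrix.one_apply, Ne.symm hb]
    · simp
  rw [h, aeval_X_left_apply]

lemma matAct_matAct (A B : Matrix (Fin 3) (Fin 3) K) (F : MvPolynomial (Fin 3) K) :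
    matAct B (matAct A F) = matAct (A * B) F := by
  unfold matAct
  rw [← AlgHom.comp_apply, comp_aeval]
  have h : (fun i => (aeval fun i => ∑ j, C (B i j) * X j) (∑ j, C (A i j) * X j))
      = fun i => ∑ j : Fin 3, C ((A * B) i j) * (X j : MvPolynomial (Fin 3) K) := by
    funext i
    simp only [map_sum, map_mul, aeval_C, aeval_X, algebraMap_eq, Finset.mul_sum]
    rw [Finset.sum_comm]
    refine Finset.sum_congr rfl fun k _ => ?_
    rw [Matrix.mul_apply, map_sum, Finset.sum_mul]
    refine Finset.sum_congr rfl fun j _ => ?_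
    rw [map_mul, mul_assoc]
  rw [h]

lemma matAct_smul (A : Matrix (Fin 3) (Fin 3) K) (c : K) (F : MvPolynomial (Fin 3) K) :
    matAct A (c • F) = c • matAct A F :=
  map_smul (aeval fun i => ∑ j, C (A i j) * X j) c F

/-- The class of a matrix `A` in `PGL₃(K)` (junk value `1` if `A` is not invertible). -/
noncomputable def pgl (A : Matrix (Fin 3) (Fin 3) K) : PGL3 K := by
  classical
  exact if h : IsUnit A then (QuotientGroup.mk h.unit : PGL3 K) else 1

/-- `F` defines a smooth plane sextic: `F` is homogeneous of degree `6`, and `F` together with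
its partial derivatives have no common zero besides the origin. -/
def IsSmoothSextic (F : MvPolynomial (Fin 3) K) : Prop :=
  F.IsHomogeneous 6 ∧
    ∀ p : Fin 3 → K, eval p F = 0 → (∀ i, eval p (pderiv i F) = 0) → p = 0

/-- The automorphism group of the plane curve `F = 0`: the subgroup of `PGL₃(K)` consisting of
the classes of matrices `A ∈ GL₃(K)` with `F(A·(X,Y,Z)ᵗ) = λ·F(X,Y,Z)` for some `λ ∈ K×`. -/
noncomputable def planeAut (F : MvPolynomial (Fin 3) K) : Subgroup (PGL3 K) where
  carrier := {g | ∃ A : GL3 K, (QuotientGroup.mk A : PGL3 K) = g ∧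
    ∃ c : K, c ≠ 0 ∧ matAct (A : Matrix (Fin 3) (Fin 3) K) F = c • F}
  one_mem' := ⟨1, rfl, 1, one_ne_zero, by rw [Units.val_one, matAct_one, one_smul]⟩
  mul_mem' := by
    rintro g h ⟨A, rfl, c, hc, hA⟩ ⟨B, rfl, d, hd, hB⟩
    exact ⟨A * B, rfl, c * d, mul_ne_zero hc hd, by
      rw [Units.val_mul, ← matAct_matAct, hA, matAct_smul, hB, smul_smul]⟩
  inv_mem' := by
    rintro g ⟨A, rfl, c, hc, hA⟩
    refine ⟨A⁻¹, rfl, c⁻¹, inv_ne_zero hc, ?_⟩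
    rw [eq_inv_smul_iff₀ hc, ← matAct_smul, ← hA, matAct_matAct, ← Units.val_mul,
      mul_inv_cancel, Units.val_one, matAct_one]

/-- The family of sextics
`32X⁶ + γ⁵X(Y⁵ + Z⁵) + 8(12 − γ⁵)X⁴YZ + 2(48 + γ⁵)X²Y²Z² + (32 − γ⁵)Y³Z³`. -/
noncomputable def gammaSextic {K : Type*} [Field K] (γ : K) : MvPolynomial (Fin 3) K :=
  C 32 * X 0 ^ 6 + C (γ ^ 5) * X 0 * (X 1 ^ 5 + X 2 ^ 5)
    + C (8 * (12 - γ ^ 5)) * X 0 ^ 4 * X 1 * X 2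
    + C (2 * (48 + γ ^ 5)) * X 0 ^ 2 * X 1 ^ 2 * X 2 ^ 2
    + C (32 - γ ^ 5) * X 1 ^ 3 * X 2 ^ 3

/-- A map of three vectors that is linear in each of them. -/
structure IsTrilinear {V : Type*} [AddCommGroup V] [Module K V] (M : V → V → V → K) : Prop where
  add_left : ∀ a b v w, M (a + b) v w = M a v w + M b v w
  smul_left : ∀ (c : K) a v w, M (c • a) v w = c * M a v w
  add_mid : ∀ u a b w, M u (a + b) w = M u a w + M u b w
  smul_mid : ∀ (c : K) u a w, M u (c • a) w = c * M u a w
  add_right : ∀ u v a b, M u v (a + b) = M u v a + M u v b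
  smul_right : ∀ (c : K) u v a, M u v (c • a) = c * M u v a

/-- The antisymmetrization of a trilinear map over one additional index. -/
def altLift {V : Type*} (M : V → V → V → K) (t u w : Fin 3 → V) : K :=
  M (t 0) (u 1) (w 2) - M (t 0) (u 2) (w 1) - M (t 1) (u 0) (w 2) + M (t 1) (u 2) (w 0)
    + M (t 2) (u 0) (w 1) - M (t 2) (u 1) (w 0)

/-- The action of a matrix on the first index of a family. -/
def indexAct {V : Type*} [AddCommGroup V] [Module K V] (A : Matrix (Fin 3) (Fin 3) K)
    (t : Fin 3 → V) : Fin 3 → V :=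
  fun i => A 0 i • t 0 + A 1 i • t 1 + A 2 i • t 2

lemma IsTrilinear.altLift {V : Type*} [AddCommGroup V] [Module K V] {M : V → V → V → K}
    (hM : IsTrilinear M) : IsTrilinear (altLift M) := by
  constructor <;> intros <;>
    simp only [_root_.altLift, Pi.add_apply, Pi.smul_apply, hM.add_left, hM.smul_left, hM.add_mid,
      hM.smul_mid, hM.add_right, hM.smul_right] <;> ring

lemma altLift_indexAct {V : Type*} [AddCommGroup V] [Module K V] {M : V → V → V → K}
    (hM : IsTrilinear M) (A : Matrix (Fin 3) (Fin 3) K) (t u w : Fin 3 → V) :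
    altLift M (indexAct A t) (indexAct A u) (indexAct A w) = A.det * altLift M t u w := by
  simp only [altLift, indexAct, hM.add_left, hM.smul_left, hM.add_mid,
      hM.smul_mid, hM.add_right, hM.smul_right, Matrix.det_fin_three]
  ring

lemma isTrilinear_mul : IsTrilinear (fun a b c : K => a * b * c) := by
  constructor <;> intros <;> (try simp only [smul_eq_mul]) <;> ring

/-- The cubic invariant of ternary quartics, as a trilinear map of tensors with four indices. -/
def quarticInvariant : (Fin 3 → Fin 3 → Fin 3 → Fin 3 → K) → (Fin 3 → Fin 3 → Fin 3 → Fin 3 → K) →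
    (Fin 3 → Fin 3 → Fin 3 → Fin 3 → K) → K :=
  altLift (altLift (altLift (altLift fun a b c : K => a * b * c)))

lemma altLift_comp {V : Type*} [AddCommGroup V] [Module K V] {M : V → V → V → K}
    (φ : V → V) (d : K) (h : ∀ t u w, M (φ t) (φ u) (φ w) = d * M t u w) (t u w : Fin 3 → V) :
    altLift M (fun i => φ (t i)) (fun i => φ (u i)) (fun i => φ (w i)) = d * altLift M t u w := by
  simp only [altLift, h]
  ring

/-- The action of a matrix on all indices of a tensor with four indices. -/
def tensorAct (A : Matrix (Fin 3) (Fin 3) K) (t : Fin 3 → Fin 3 → Fin 3 → Fin 3 → K) :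
    Fin 3 → Fin 3 → Fin 3 → Fin 3 → K :=
  indexAct A fun i => indexAct A fun j => indexAct A fun k => indexAct A (t i j k)

lemma quarticInvariant_tensorAct (A : Matrix (Fin 3) (Fin 3) K)
    (t : Fin 3 → Fin 3 → Fin 3 → Fin 3 → K) :
    quarticInvariant (tensorAct A t) (tensorAct A t) (tensorAct A t)
      = A.det ^ 4 * quarticInvariant t t t := by
  have h1 := isTrilinear_mul (K := K)
  have h2 := h1.altLift
  have h3 := h2.altLift
  have h4 := h3.altLift
  unfold quarticInvariant tensorAct
  rw [altLift_indexAct h4,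
    altLift_comp (fun s => indexAct A fun j => indexAct A fun k => indexAct A (s j k)) (A.det ^ 3)]
  · ring
  intro t u w
  rw [altLift_indexAct h3,
    altLift_comp (fun s => indexAct A fun k => indexAct A (s k)) (A.det ^ 2)]
  · ring
  intro t u w
  rw [altLift_indexAct h2, altLift_comp (fun s => indexAct A s) A.det]
  · ring
  exact altLift_indexAct h1 A

lemma matAct_add (A : Matrix (Fin 3) (Fin 3) K) (F G : MvPolynomial (Fin 3) K) :
    matAct A (F + G) = matAct A F + matAct A G :=
  map_add _ F G

lemma matAct_mul (A : Matrix (Fin 3) (Fin 3) K) (F G : MvPolynomial (Fin 3) K) :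
    matAct A (F * G) = matAct A F * matAct A G :=
  map_mul _ F G

lemma matAct_X (A : Matrix (Fin 3) (Fin 3) K) (i : Fin 3) :
    matAct A (X i) = ∑ j, C (A i j) * X j :=
  aeval_X _ i

lemma matAct_C (A : Matrix (Fin 3) (Fin 3) K) (a : K) : matAct A (C a) = C a :=
  aeval_C _ a

lemma eval_matAct (A : Matrix (Fin 3) (Fin 3) K) (F : MvPolynomial (Fin 3) K) (v : Fin 3 → K) :
    eval v (matAct A F) = eval (A.mulVec v) F := by
  induction F using MvPolynomial.induction_on with
  | C a => rw [matAct_C, eval_C, eval_C]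
  | add p q hp hq => simp only [matAct_add, map_add, hp, hq]
  | mul_X p i hp => simp [matAct_mul, matAct_X, hp, Matrix.mulVec, dotProduct]

lemma matAct_eq_smul_iff [Infinite K] (A : Matrix (Fin 3) (Fin 3) K) (c : K)
    (F : MvPolynomial (Fin 3) K) :
    matAct A F = c • F ↔ ∀ v, eval (A.mulVec v) F = c * eval v F := by
  constructor
  · intro h v
    rw [← eval_matAct, h, smul_eval]
  · intro h
    refine MvPolynomial.funext fun v => ?_
    rw [eval_matAct, h, smul_eval]

lemma pderiv_matAct (A : Matrix (Fin 3) (Fin 3) K) (F : MvPolynomial (Fin 3) K) (j : Fin 3) :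
    pderiv j (matAct A F) = A 0 j • matAct A (pderiv 0 F) + A 1 j • matAct A (pderiv 1 F)
      + A 2 j • matAct A (pderiv 2 F) := by
  have h0 : matAct A 0 = 0 := map_zero _
  have h1 : matAct A 1 = 1 := map_one _
  induction F using MvPolynomial.induction_on with
  | C a => simp [matAct_C, h0]
  | add p q hp hq => simp only [matAct_add, map_add, hp, hq, smul_add]; ring
  | mul_X p i hp =>
    simp only [matAct_mul, matAct_X, matAct_add, Derivation.leibniz, hp, map_add, smul_eq_mul,
      pderiv_X, Fin.sum_univ_three, pderiv_C, MvPolynomial.smul_eq_C_mul]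
    fin_cases i <;> fin_cases j <;>
      simp [h0, h1] <;> ring

/-- The tensor of fourth derivatives of a polynomial at a point. -/
noncomputable def derivTensor (F : MvPolynomial (Fin 3) K) (v : Fin 3 → K) (i j k l : Fin 3) : K :=
  eval v (pderiv l (pderiv k (pderiv j (pderiv i F))))

lemma derivTensor_matAct (A : Matrix (Fin 3) (Fin 3) K) (F : MvPolynomial (Fin 3) K)
    (v : Fin 3 → K) :
    derivTensor (matAct A F) v = tensorAct A (derivTensor F (A.mulVec v)) := by
  funext i j k l
  simp only [derivTensor, pderiv_matAct, map_add, Derivation.map_smul, eval_matAct, smul_eval,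
    tensorAct, indexAct, Pi.add_apply, Pi.smul_apply, smul_eq_mul]

/-- The tensor with four indices encoding a ternary quartic whose coefficients are listed by the
number of indices `1` plus five times the number of indices `2`. -/
def codeTensor (c : ℕ → K) (i j k l : Fin 3) : K :=
  c (![0, 1, 5] i + ![0, 1, 5] j + ![0, 1, 5] k + ![0, 1, 5] l)

lemma quarticInvariant_codeTensor (c : ℕ → K) :
    quarticInvariant (codeTensor c) (codeTensor c) (codeTensor c) =
      6 * c 0 * c 4 * c 20 - 24 * c 0 * c 8 * c 16 - 24 * c 1 * c 3 * c 20
        + 24 * c 1 * c 15 * c 8 + 24 * c 5 * c 3 * c 16 - 24 * c 5 * c 15 * c 4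
        + 18 * c 0 * c 12 * c 12 + 72 * c 1 * c 7 * c 16 - 72 * c 1 * c 11 * c 12
        - 72 * c 5 * c 7 * c 12 + 72 * c 5 * c 11 * c 8 + 18 * c 2 * c 2 * c 20
        - 72 * c 2 * c 7 * c 15 - 72 * c 2 * c 6 * c 16 + 72 * c 6 * c 3 * c 15
        + 36 * c 2 * c 10 * c 12 - 72 * c 6 * c 7 * c 11 - 72 * c 6 * c 10 * c 8
        - 72 * c 10 * c 3 * c 11 + 18 * c 10 * c 10 * c 4 + 72 * c 2 * c 11 * c 11
        + 72 * c 6 * c 6 * c 12 + 72 * c 10 * c 7 * c 7 := by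
  simp only [quarticInvariant, altLift, codeTensor, Matrix.cons_val, Nat.reduceAdd]
  ring

/-- The pencil of plane sextics spanned by `32 (X² + YZ)³` and the Clebsch sextic. -/
noncomputable def pencil (g : K) : MvPolynomial (Fin 3) K :=
  C 32 * X 0 ^ 6 + C g * X 0 * (X 1 ^ 5 + X 2 ^ 5)
    + C (8 * (12 - g)) * X 0 ^ 4 * X 1 * X 2
    + C (2 * (48 + g)) * X 0 ^ 2 * X 1 ^ 2 * X 2 ^ 2
    + C (32 - g) * X 1 ^ 3 * X 2 ^ 3

/-- The invariant conic. -/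
def conic (v : Fin 3 → K) : K := v 0 ^ 2 + v 1 * v 2

/-- The invariant Clebsch sextic. -/
def clebsch (v : Fin 3 → K) : K :=
  v 0 * (v 1 ^ 5 + v 2 ^ 5) - 8 * v 0 ^ 4 * v 1 * v 2 + 2 * v 0 ^ 2 * v 1 ^ 2 * v 2 ^ 2
    - v 1 ^ 3 * v 2 ^ 3

lemma eval_pencil (g : K) (v : Fin 3 → K) :
    eval v (pencil g) = 32 * conic v ^ 3 + g * clebsch v := by
  simp only [pencil, conic, clebsch, map_add, map_mul, map_pow, eval_C, eval_X]
  ring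

/-- The fourth derivatives of the sextics of the pencil. -/
def pencilDeriv (g : K) (v : Fin 3 → K) : ℕ → K
  | 0 => 11520 * v 0 ^ 2 - 192 * v 1 * v 2 * g + 2304 * v 1 * v 2
  | 1 => -192 * v 0 * v 2 * g + 2304 * v 0 * v 2
  | 2 => 8 * v 2 ^ 2 * g + 384 * v 2 ^ 2
  | 3 => 60 * v 1 ^ 2 * g
  | 4 => 120 * v 0 * v 1 * g
  | 5 => -192 * v 0 * v 1 * g + 2304 * v 0 * v 1
  | 6 => -96 * v 0 ^ 2 * g + 1152 * v 0 ^ 2 + 16 * v 1 * v 2 * g + 768 * v 1 * v 2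
  | 7 => 16 * v 0 * v 2 * g + 768 * v 0 * v 2
  | 8 => -18 * v 2 ^ 2 * g + 576 * v 2 ^ 2
  | 10 => 8 * v 1 ^ 2 * g + 384 * v 1 ^ 2
  | 11 => 16 * v 0 * v 1 * g + 768 * v 0 * v 1
  | 12 => 8 * v 0 ^ 2 * g + 384 * v 0 ^ 2 - 36 * v 1 * v 2 * g + 1152 * v 1 * v 2
  | 15 => 60 * v 2 ^ 2 * g
  | 16 => -18 * v 1 ^ 2 * g + 576 * v 1 ^ 2
  | 20 => 120 * v 0 * v 2 * g
  | _ => 0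

lemma pderiv_monomial_three (a b c : ℕ) (i : Fin 3) :
    pderiv i (X 0 ^ a * X 1 ^ b * X 2 ^ c : MvPolynomial (Fin 3) K) =
      ((![a, b, c] i : ℕ) : K) • (X 0 ^ (a - ![1, 0, 0] i) * X 1 ^ (b - ![0, 1, 0] i)
        * X 2 ^ (c - ![0, 0, 1] i)) := by
  fin_cases i <;> simp [Derivation.leibniz, pderiv_X, smul_eq_C_mul] <;> ring

set_option maxHeartbeats 4000000 in
lemma derivTensor_pencil (g : K) (v : Fin 3 → K) :
    derivTensor (pencil g) v = codeTensor (pencilDeriv g v) := by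
  have h : pencil g = (32 : K) • (X 0 ^ 6 * X 1 ^ 0 * X 2 ^ 0) + g • (X 0 ^ 1 * X 1 ^ 5 * X 2 ^ 0)
      + g • (X 0 ^ 1 * X 1 ^ 0 * X 2 ^ 5) + (8 * (12 - g)) • (X 0 ^ 4 * X 1 ^ 1 * X 2 ^ 1)
      + (2 * (48 + g)) • (X 0 ^ 2 * X 1 ^ 2 * X 2 ^ 2)
      + (32 - g) • (X 0 ^ 0 * X 1 ^ 3 * X 2 ^ 3) := by
    simp only [pencil, smul_eq_C_mul]
    ring
  funext i j k l
  rw [derivTensor, h]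
  simp only [map_add, Derivation.map_smul, pderiv_monomial_three, smul_eval, map_mul, map_pow, eval_X,
    codeTensor]
  fin_cases i <;> fin_cases j <;> fin_cases k <;> fin_cases l <;>
    simp [pencilDeriv] <;> ring

lemma quarticInvariant_pencil (g : K) (v : Fin 3 → K) :
    quarticInvariant (derivTensor (pencil g) v) (derivTensor (pencil g) v)
      (derivTensor (pencil g) v) =
      6 * ((884736 * g ^ 3 + 23445504 * g ^ 2 - 679477248 * g + 11211374592) * conic v ^ 3
        + (760320 * g ^ 3 - 43130880 * g ^ 2 + 159252480 * g) * clebsch v) := by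
  rw [derivTensor_pencil, quarticInvariant_codeTensor]
  simp only [pencilDeriv, conic, clebsch]
  ring

lemma derivTensor_smul (c : K) (F : MvPolynomial (Fin 3) K) (v : Fin 3 → K) :
    derivTensor (c • F) v = c • derivTensor F v := by
  funext i j k l
  simp only [derivTensor, Derivation.map_smul, smul_eval, Pi.smul_apply, smul_eq_mul]

lemma quarticInvariant_smul (c : K) (t : Fin 3 → Fin 3 → Fin 3 → Fin 3 → K) :
    quarticInvariant (c • t) (c • t) (c • t) = c ^ 3 * quarticInvariant t t t := by
  have h := (isTrilinear_mul (K := K)).altLift.altLift.altLift.altLift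
  unfold quarticInvariant
  rw [h.smul_left, h.smul_mid, h.smul_right]
  ring

lemma exists_conic_mulVec (A : Matrix (Fin 3) (Fin 3) K) :
    ∃ a b c d e f : K, ∀ x y z : K, conic (A.mulVec ![x, y, z])
      = a * x ^ 2 + b * x * y + c * x * z + d * y * z + e * y ^ 2 + f * z ^ 2 := by
  refine ⟨A 0 0 ^ 2 + A 1 0 * A 2 0, 2 * A 0 0 * A 0 1 + A 1 0 * A 2 1 + A 1 1 * A 2 0,
    2 * A 0 0 * A 0 2 + A 1 0 * A 2 2 + A 1 2 * A 2 0,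
    2 * A 0 1 * A 0 2 + A 1 1 * A 2 2 + A 1 2 * A 2 1, A 0 1 ^ 2 + A 1 1 * A 2 1,
    A 0 2 ^ 2 + A 1 2 * A 2 2, fun x y z => ?_⟩
  simp [conic, Matrix.mulVec, dotProduct, Fin.sum_univ_three]
  ring

/-- If the pencil of sextics contains the cube of a nondegenerate quadratic form, then that form
is proportional to the invariant conic. -/
lemma conic_mulVec_of_cube [CharZero K] {A : Matrix (Fin 3) (Fin 3) K} (hA : A.det ≠ 0) {α β : K}
    (h : ∀ v, conic (A.mulVec v) ^ 3 = α * conic v ^ 3 + β * clebsch v) :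
    ∃ d : K, d ≠ 0 ∧ ∀ v, conic (A.mulVec v) = d * conic v := by
  obtain ⟨a, b, c, d, e, f, hq⟩ := exists_conic_mulVec A
  have h' : ∀ x y z : K,
      (a * x ^ 2 + b * x * y + c * x * z + d * y * z + e * y ^ 2 + f * z ^ 2) ^ 3
        = α * (x ^ 2 + y * z) ^ 3 + β * (x * (y ^ 5 + z ^ 5) - 8 * x ^ 4 * y * z
          + 2 * x ^ 2 * y ^ 2 * z ^ 2 - y ^ 3 * z ^ 3) := by
    intro x y z
    rw [← hq, h]
    simp [conic, clebsch]
  have he : e = 0 := pow_eq_zero_iff three_ne_zero |>.1 (by linear_combination h' 0 1 0)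
  have hf : f = 0 := pow_eq_zero_iff three_ne_zero |>.1 (by linear_combination h' 0 0 1)
  subst he hf
  have hα : α = a ^ 3 := by linear_combination -h' 1 0 0
  subst hα
  have hb : b = 0 ∧ β = 0 := by
    have h1 : a * b ^ 2 = 0 := by linear_combination (1 / 6) * h' 1 1 0 + (1 / 6) * h' (-1) 1 0
    rcases mul_eq_zero.1 h1 with h2 | h2
    · subst h2
      have hβ : β = 0 := by linear_combination (1 / 6 : K) * h' 2 1 0 - (8 / 6) * h' 1 1 0
      exact ⟨pow_eq_zero_iff three_ne_zero |>.1 (by linear_combination h' 1 1 0 + hβ), hβ⟩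
    · have h3 : b = 0 := pow_eq_zero_iff two_ne_zero |>.1 h2
      subst h3
      exact ⟨rfl, by linear_combination -h' 1 1 0⟩
  obtain ⟨rfl, rfl⟩ := hb
  have hc : c = 0 := by
    have h1 : a * c ^ 2 = 0 := by linear_combination (1 / 6) * h' 1 0 1 + (1 / 6) * h' (-1) 0 1
    rcases mul_eq_zero.1 h1 with h2 | h2
    · subst h2
      exact pow_eq_zero_iff three_ne_zero |>.1 (by linear_combination h' 1 0 1)
    · exact pow_eq_zero_iff two_ne_zero |>.1 h2
  subst hc
  have hd : a - d = 0 := pow_eq_zero_iff three_ne_zero |>.1 (by linear_combination h' 1 1 (-1))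
  have hd' : d = a := by linear_combination -hd
  subst hd'
  have hv : ∀ v, conic (A.mulVec v) = d * conic v := by
    intro v
    have hv : v = ![v 0, v 1, v 2] := by
      funext i
      fin_cases i <;> rfl
    rw [hv, hq]
    simp [conic]
    ring
  refine ⟨d, ?_, hv⟩
  rintro rfl
  have h1 := hv (A⁻¹.mulVec ![1, 0, 0])
  rw [Matrix.mulVec_mulVec, Matrix.mul_nonsing_inv _ (Ne.isUnit hA), Matrix.one_mulVec] at h1
  simp [conic] at h1

lemma conic_mulVec_of_generic [CharZero K] {g : K} (hg : g ≠ 0) (hg8 : g ≠ -8)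
    (hw : g ^ 2 - 9 * g + 864 ≠ 0) {A : Matrix (Fin 3) (Fin 3) K} (hA : A.det ≠ 0) {c : K}
    (h : matAct A (pencil g) = c • pencil g) :
    ∃ d : K, d ≠ 0 ∧ ∀ v, conic (A.mulVec v) = d * conic v := by
  have key : A.det ^ 4 * (g * (g + 8) * (g ^ 2 - 9 * g + 864)) ≠ 0 :=
    mul_ne_zero (pow_ne_zero _ hA) (mul_ne_zero (mul_ne_zero hg fun h => hg8
      (by linear_combination h)) hw)
  set P : K := 884736 * g ^ 3 + 23445504 * g ^ 2 - 679477248 * g + 11211374592 with hP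
  set Q : K := 760320 * g ^ 3 - 43130880 * g ^ 2 + 159252480 * g with hQ
  refine conic_mulVec_of_cube hA
    (α := (c ^ 3 * g * P - 32 * A.det ^ 4 * Q * c) /
      (884736 * (A.det ^ 4 * (g * (g + 8) * (g ^ 2 - 9 * g + 864)))))
    (β := (c ^ 3 * g * Q - A.det ^ 4 * Q * c * g) /
      (884736 * (A.det ^ 4 * (g * (g + 8) * (g ^ 2 - 9 * g + 864))))) fun v => ?_
  have h1 := (eval_matAct A (pencil g) v).symm
  rw [h, smul_eval, eval_pencil, eval_pencil] at h1
  have h2 := quarticInvariant_tensorAct A (derivTensor (pencil g) (A.mulVec v))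
  rw [← derivTensor_matAct, h, derivTensor_smul, quarticInvariant_smul, quarticInvariant_pencil,
    quarticInvariant_pencil, ← hP, ← hQ] at h2
  rw [div_mul_eq_mul_div, div_mul_eq_mul_div, ← add_div,
    eq_div_iff (mul_ne_zero (by norm_num) key)]
  linear_combination (-(g / 6)) * h2 - A.det ^ 4 * Q * h1
    + conic (A.mulVec v) ^ 3 * A.det ^ 4 * (32 * hQ - g * hP)

/-- The matrix describing the action on the dual plane, which is identified with the plane by
means of the invariant conic. -/
def dualMat (A : Matrix (Fin 3) (Fin 3) K) : Matrix (Fin 3) (Fin 3) K :=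
  !![A 1 1 * A 2 2 - A 1 2 * A 2 1, (A 1 0 * A 2 1 - A 1 1 * A 2 0) / 2,
      (A 1 2 * A 2 0 - A 1 0 * A 2 2) / 2;
    2 * (A 0 1 * A 1 2 - A 0 2 * A 1 1), A 0 0 * A 1 1 - A 0 1 * A 1 0,
      A 0 2 * A 1 0 - A 0 0 * A 1 2;
    2 * (A 0 2 * A 2 1 - A 0 1 * A 2 2), A 0 1 * A 2 0 - A 0 0 * A 2 1,
      A 0 0 * A 2 2 - A 0 2 * A 2 0]

/-- The pole, with respect to the invariant conic, of the line through two points. -/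
def polePoint (m n : Fin 3 → K) : Fin 3 → K :=
  ![(m 1 * n 2 - m 2 * n 1) / 2, m 0 * n 1 - m 1 * n 0, m 2 * n 0 - m 0 * n 2]

lemma polePoint_mulVec [CharZero K] (A : Matrix (Fin 3) (Fin 3) K) (m n : Fin 3 → K) :
    polePoint (A.mulVec m) (A.mulVec n) = (dualMat A).mulVec (polePoint m n) := by
  funext i
  fin_cases i <;> simp [polePoint, dualMat, Matrix.mulVec, dotProduct, Fin.sum_univ_three] <;> ring

lemma exists_polePoint [CharZero K] (w : Fin 3 → K) : ∃ m n, polePoint m n = w := by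
  by_cases h0 : w 0 = 0
  · by_cases h1 : w 1 = 0
    · refine ⟨![-w 2, 0, 0], ![0, 0, 1], ?_⟩
      funext i
      fin_cases i <;> simp [polePoint, h0, h1]
    · refine ⟨![1, 0, 0], ![0, w 1, -w 2], ?_⟩
      funext i
      fin_cases i <;> simp [polePoint, h0]
  · refine ⟨![-w 2 / (2 * w 0), 1, 0], ![-w 1, 0, 2 * w 0], ?_⟩
    funext i
    fin_cases i <;> simp [polePoint]
    field_simp

lemma dualMat_dualMat [CharZero K] (A : Matrix (Fin 3) (Fin 3) K) :
    dualMat (dualMat A) = A.det • A := by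
  ext i j
  fin_cases i <;> fin_cases j <;> simp [dualMat, Matrix.det_fin_three] <;> ring

lemma det_dualMat [CharZero K] (A : Matrix (Fin 3) (Fin 3) K) : (dualMat A).det = A.det ^ 2 := by
  simp [dualMat, Matrix.det_fin_three]
  ring

lemma conic_polePoint [CharZero K] (m n : Fin 3 → K) : conic (polePoint m n)
    = (conic (m + n) - conic m - conic n) ^ 2 / 4 - conic m * conic n := by
  simp [conic, polePoint]
  ring

lemma conic_dualMat_mulVec [CharZero K] {A : Matrix (Fin 3) (Fin 3) K} {d : K}
    (h : ∀ v, conic (A.mulVec v) = d * conic v) (w : Fin 3 → K) :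
    conic ((dualMat A).mulVec w) = d ^ 2 * conic w := by
  obtain ⟨m, n, rfl⟩ := exists_polePoint w
  rw [← polePoint_mulVec, conic_polePoint, conic_polePoint, ← Matrix.mulVec_add, h, h, h]
  ring

/-- The coefficients of the restriction of a sextic of the pencil to a line. -/
def lineCoeff (m n : Fin 3 → K) : ℕ → K
  | 0 => 32 * m 0 ^ 6 + 160 * m 0 ^ 4 * m 1 * m 2 + 80 * m 0 ^ 2 * m 1 ^ 2 * m 2 ^ 2 - 8 * m 0 *
    m 1 ^ 5 - 8 * m 0 * m 2 ^ 5 + 40 * m 1 ^ 3 * m 2 ^ 3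
  | 1 => 192 * m 0 ^ 5 * n 0 + 160 * m 0 ^ 4 * m 1 * n 2 + 160 * m 0 ^ 4 * m 2 * n 1 + 640 * m 0
    ^ 3 * m 1 * m 2 * n 0 + 160 * m 0 ^ 2 * m 1 ^ 2 * m 2 * n 2 + 160 * m 0 ^ 2 * m 1 * m 2 ^ 2
    * n 1 - 40 * m 0 * m 1 ^ 4 * n 1 + 160 * m 0 * m 1 ^ 2 * m 2 ^ 2 * n 0 - 40 * m 0 * m 2 ^ 4
    * n 2 - 8 * m 1 ^ 5 * n 0 + 120 * m 1 ^ 3 * m 2 ^ 2 * n 2 + 120 * m 1 ^ 2 * m 2 ^ 3 * n 1 -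
    8 * m 2 ^ 5 * n 0
  | 2 => 480 * m 0 ^ 4 * n 0 ^ 2 + 160 * m 0 ^ 4 * n 1 * n 2 + 640 * m 0 ^ 3 * m 1 * n 0 * n 2 +
    640 * m 0 ^ 3 * m 2 * n 0 * n 1 + 80 * m 0 ^ 2 * m 1 ^ 2 * n 2 ^ 2 + 960 * m 0 ^ 2 * m 1 * m
    2 * n 0 ^ 2 + 320 * m 0 ^ 2 * m 1 * m 2 * n 1 * n 2 + 80 * m 0 ^ 2 * m 2 ^ 2 * n 1 ^ 2 - 80
    * m 0 * m 1 ^ 3 * n 1 ^ 2 + 320 * m 0 * m 1 ^ 2 * m 2 * n 0 * n 2 + 320 * m 0 * m 1 * m 2 ^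
    2 * n 0 * n 1 - 80 * m 0 * m 2 ^ 3 * n 2 ^ 2 - 40 * m 1 ^ 4 * n 0 * n 1 + 120 * m 1 ^ 3 * m
    2 * n 2 ^ 2 + 80 * m 1 ^ 2 * m 2 ^ 2 * n 0 ^ 2 + 360 * m 1 ^ 2 * m 2 ^ 2 * n 1 * n 2 + 120 *
    m 1 * m 2 ^ 3 * n 1 ^ 2 - 40 * m 2 ^ 4 * n 0 * n 2
  | 3 => 640 * m 0 ^ 3 * n 0 ^ 3 + 640 * m 0 ^ 3 * n 0 * n 1 * n 2 + 960 * m 0 ^ 2 * m 1 * n 0 ^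
    2 * n 2 + 160 * m 0 ^ 2 * m 1 * n 1 * n 2 ^ 2 + 960 * m 0 ^ 2 * m 2 * n 0 ^ 2 * n 1 + 160 *
    m 0 ^ 2 * m 2 * n 1 ^ 2 * n 2 + 160 * m 0 * m 1 ^ 2 * n 0 * n 2 ^ 2 - 80 * m 0 * m 1 ^ 2 * n
    1 ^ 3 + 640 * m 0 * m 1 * m 2 * n 0 ^ 3 + 640 * m 0 * m 1 * m 2 * n 0 * n 1 * n 2 + 160 * m
    0 * m 2 ^ 2 * n 0 * n 1 ^ 2 - 80 * m 0 * m 2 ^ 2 * n 2 ^ 3 - 80 * m 1 ^ 3 * n 0 * n 1 ^ 2 +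
    40 * m 1 ^ 3 * n 2 ^ 3 + 160 * m 1 ^ 2 * m 2 * n 0 ^ 2 * n 2 + 360 * m 1 ^ 2 * m 2 * n 1 * n
    2 ^ 2 + 160 * m 1 * m 2 ^ 2 * n 0 ^ 2 * n 1 + 360 * m 1 * m 2 ^ 2 * n 1 ^ 2 * n 2 - 80 * m 2
    ^ 3 * n 0 * n 2 ^ 2 + 40 * m 2 ^ 3 * n 1 ^ 3
  | 4 => 480 * m 0 ^ 2 * n 0 ^ 4 + 960 * m 0 ^ 2 * n 0 ^ 2 * n 1 * n 2 + 80 * m 0 ^ 2 * n 1 ^ 2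
    * n 2 ^ 2 + 640 * m 0 * m 1 * n 0 ^ 3 * n 2 + 320 * m 0 * m 1 * n 0 * n 1 * n 2 ^ 2 - 40 * m
    0 * m 1 * n 1 ^ 4 + 640 * m 0 * m 2 * n 0 ^ 3 * n 1 + 320 * m 0 * m 2 * n 0 * n 1 ^ 2 * n 2
    - 40 * m 0 * m 2 * n 2 ^ 4 + 80 * m 1 ^ 2 * n 0 ^ 2 * n 2 ^ 2 - 80 * m 1 ^ 2 * n 0 * n 1 ^ 3
    + 120 * m 1 ^ 2 * n 1 * n 2 ^ 3 + 160 * m 1 * m 2 * n 0 ^ 4 + 320 * m 1 * m 2 * n 0 ^ 2 * n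
    1 * n 2 + 360 * m 1 * m 2 * n 1 ^ 2 * n 2 ^ 2 + 80 * m 2 ^ 2 * n 0 ^ 2 * n 1 ^ 2 - 80 * m 2
    ^ 2 * n 0 * n 2 ^ 3 + 120 * m 2 ^ 2 * n 1 ^ 3 * n 2
  | 5 => 192 * m 0 * n 0 ^ 5 + 640 * m 0 * n 0 ^ 3 * n 1 * n 2 + 160 * m 0 * n 0 * n 1 ^ 2 * n 2
    ^ 2 - 8 * m 0 * n 1 ^ 5 - 8 * m 0 * n 2 ^ 5 + 160 * m 1 * n 0 ^ 4 * n 2 + 160 * m 1 * n 0 ^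
    2 * n 1 * n 2 ^ 2 - 40 * m 1 * n 0 * n 1 ^ 4 + 120 * m 1 * n 1 ^ 2 * n 2 ^ 3 + 160 * m 2 * n
    0 ^ 4 * n 1 + 160 * m 2 * n 0 ^ 2 * n 1 ^ 2 * n 2 - 40 * m 2 * n 0 * n 2 ^ 4 + 120 * m 2 * n
    1 ^ 3 * n 2 ^ 2
  | 6 => 32 * n 0 ^ 6 + 160 * n 0 ^ 4 * n 1 * n 2 + 80 * n 0 ^ 2 * n 1 ^ 2 * n 2 ^ 2 - 8 * n 0 *
    n 1 ^ 5 - 8 * n 0 * n 2 ^ 5 + 40 * n 1 ^ 3 * n 2 ^ 3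
  | _ => 0

lemma eval_pencil_line (m n : Fin 3 → K) (s : K) :
    eval (m + s • n) (pencil (-8)) = ∑ j ∈ Finset.range 7, lineCoeff m n j * s ^ j := by
  simp only [eval_pencil, conic, clebsch, Pi.add_apply, Pi.smul_apply, smul_eq_mul,
    Finset.sum_range_succ, Finset.sum_range_zero, lineCoeff]
  ring

lemma lineCoeff_invariant [CharZero K] (m n : Fin 3 → K) :
    120 * lineCoeff m n 0 * lineCoeff m n 6 - 20 * lineCoeff m n 1 * lineCoeff m n 5
      + 8 * lineCoeff m n 2 * lineCoeff m n 4 - 3 * lineCoeff m n 3 ^ 2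
      = -9600 * eval (polePoint m n) (pencil (16 / 3)) := by
  simp only [eval_pencil, conic, clebsch, polePoint, lineCoeff, Matrix.cons_val]
  ring

lemma coeff_eq_of_sum_eq [CharZero K] {N : ℕ} {a b : ℕ → K}
    (h : ∀ s : K, ∑ j ∈ Finset.range N, a j * s ^ j = ∑ j ∈ Finset.range N, b j * s ^ j)
    {j : ℕ} (hj : j < N) : a j = b j := by
  have h1 : ∑ j ∈ Finset.range N, Polynomial.C (a j) * Polynomial.X ^ j
      = ∑ j ∈ Finset.range N, Polynomial.C (b j) * Polynomial.X ^ j := by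
    refine Polynomial.funext fun s => ?_
    simpa [Polynomial.eval_finsetSum] using h s
  have h2 := congrArg (fun p => Polynomial.coeff p j) h1
  simpa [Polynomial.finsetSum_coeff, Polynomial.coeff_C_mul, Polynomial.coeff_X_pow, hj] using h2

lemma conic_mulVec_of_special [CharZero K] {A : Matrix (Fin 3) (Fin 3) K} (hA : A.det ≠ 0) {c : K}
    (h : matAct A (pencil (-8)) = c • pencil (-8)) :
    ∃ d : K, d ≠ 0 ∧ ∀ v, conic (A.mulVec v) = d * conic v := by
  have h1 : ∀ m n j, j < 7 → lineCoeff (A.mulVec m) (A.mulVec n) j = c * lineCoeff m n j := by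
    intro m n j hj
    refine coeff_eq_of_sum_eq (b := fun j => c * lineCoeff m n j) (fun s => ?_) hj
    rw [← eval_pencil_line, ← Matrix.mulVec_smul, ← Matrix.mulVec_add, ← eval_matAct, h, smul_eval,
      eval_pencil_line, Finset.mul_sum]
    simp only [mul_assoc]
  have h2 : matAct (dualMat A) (pencil (16 / 3)) = c ^ 2 • pencil (16 / 3) := by
    refine (matAct_eq_smul_iff _ _ _).2 fun w => ?_
    obtain ⟨m, n, rfl⟩ := exists_polePoint w
    have h3 := lineCoeff_invariant (A.mulVec m) (A.mulVec n)
    rw [h1 _ _ 0 (by simp), h1 _ _ 1 (by simp), h1 _ _ 2 (by simp), h1 _ _ 3 (by simp),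
      h1 _ _ 4 (by simp), h1 _ _ 5 (by simp), h1 _ _ 6 (by simp), polePoint_mulVec] at h3
    have h4 := lineCoeff_invariant m n
    linear_combination (1 / 9600) * h3 - (c ^ 2 / 9600) * h4
  obtain ⟨d, hd, h3⟩ := conic_mulVec_of_generic (by norm_num) (by norm_num) (by norm_num)
    (by rw [det_dualMat]; exact pow_ne_zero _ hA) h2
  have h4 := conic_dualMat_mulVec h3
  refine ⟨d ^ 2 / A.det ^ 2, div_ne_zero (pow_ne_zero _ hd) (pow_ne_zero _ hA), fun v => ?_⟩
  have h5 := h4 v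
  rw [dualMat_dualMat, Matrix.smul_mulVec] at h5
  have h6 : conic (A.det • A.mulVec v) = A.det ^ 2 * conic (A.mulVec v) := by
    simp only [conic, Pi.smul_apply, smul_eq_mul]
    ring
  rw [h6] at h5
  field_simp
  linear_combination h5

/-- Outside the two Wiman parameters, automorphisms of a sextic of the pencil preserve the
conic. -/
lemma conic_mulVec [CharZero K] {g : K} (hg : g ≠ 0) (hw : g ^ 2 - 9 * g + 864 ≠ 0)
    {A : Matrix (Fin 3) (Fin 3) K} (hA : A.det ≠ 0) {c : K}
    (h : matAct A (pencil g) = c • pencil g) :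
    ∃ d : K, d ≠ 0 ∧ ∀ v, conic (A.mulVec v) = d * conic v := by
  by_cases hg8 : g = -8
  · subst hg8
    exact conic_mulVec_of_special hA h
  · exact conic_mulVec_of_generic hg hg8 hw hA h

lemma pgl_of_isUnit {A : Matrix (Fin 3) (Fin 3) K} (hA : IsUnit A) :
    pgl A = (QuotientGroup.mk hA.unit : PGL3 K) :=
  dif_pos hA

lemma pgl_unit (A : GL3 K) :
    pgl (A : Matrix (Fin 3) (Fin 3) K) = (QuotientGroup.mk A : PGL3 K) := by
  rw [pgl_of_isUnit A.isUnit]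
  congr 1
  ext1
  rfl

lemma exists_unit_of_det_ne_zero {A : Matrix (Fin 3) (Fin 3) K} (hA : A.det ≠ 0) :
    ∃ U : GL3 K, (U : Matrix (Fin 3) (Fin 3) K) = A :=
  (Matrix.isUnit_iff_isUnit_det A).2 (isUnit_iff_ne_zero.2 hA)

lemma det_unit_ne_zero (U : GL3 K) : (U : Matrix (Fin 3) (Fin 3) K).det ≠ 0 :=
  isUnit_iff_ne_zero.1 ((Matrix.isUnit_iff_isUnit_det _).1 U.isUnit)

lemma pgl_mul {A B : Matrix (Fin 3) (Fin 3) K} (hA : A.det ≠ 0) (hB : B.det ≠ 0) :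
    pgl (A * B) = pgl A * pgl B := by
  obtain ⟨U, rfl⟩ := exists_unit_of_det_ne_zero hA
  obtain ⟨V, rfl⟩ := exists_unit_of_det_ne_zero hB
  rw [← Units.val_mul, pgl_unit, pgl_unit, pgl_unit, QuotientGroup.mk_mul]

lemma pgl_one : pgl (1 : Matrix (Fin 3) (Fin 3) K) = 1 := by
  rw [← Units.val_one, pgl_unit, QuotientGroup.mk_one]

lemma pgl_pow {A : Matrix (Fin 3) (Fin 3) K} (hA : A.det ≠ 0) (n : ℕ) :
    pgl (A ^ n) = pgl A ^ n := by
  obtain ⟨U, rfl⟩ := exists_unit_of_det_ne_zero hA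
  rw [← Units.val_pow_eq_pow_val, pgl_unit, pgl_unit, QuotientGroup.mk_pow]

lemma pgl_smul {c : K} (hc : c ≠ 0) {A : Matrix (Fin 3) (Fin 3) K} (hA : A.det ≠ 0) :
    pgl (c • A) = pgl A := by
  obtain ⟨U, rfl⟩ := exists_unit_of_det_ne_zero hA
  obtain ⟨V, hV⟩ := exists_unit_of_det_ne_zero (A := c • (U : Matrix (Fin 3) (Fin 3) K)) (by
    rw [Matrix.det_smul]
    exact mul_ne_zero (pow_ne_zero _ hc) hA)
  rw [← hV, pgl_unit, pgl_unit, QuotientGroup.eq, Subgroup.mem_center_iff]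
  have key : ((V⁻¹ * U : GL3 K) : Matrix (Fin 3) (Fin 3) K) = c⁻¹ • 1 := by
    rw [eq_inv_smul_iff₀ hc, Units.val_mul, ← Matrix.mul_smul, ← hV, ← Units.val_mul,
      inv_mul_cancel, Units.val_one]
  intro W
  ext1
  rw [Units.val_mul W, Units.val_mul (V⁻¹ * U), key]
  simp

lemma exists_smul_of_pgl_eq {A B : Matrix (Fin 3) (Fin 3) K} (hA : A.det ≠ 0) (hB : B.det ≠ 0)
    (h : pgl A = pgl B) : ∃ c : K, B = c • A := by
  obtain ⟨U, rfl⟩ := exists_unit_of_det_ne_zero hA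
  obtain ⟨V, rfl⟩ := exists_unit_of_det_ne_zero hB
  rw [pgl_unit, pgl_unit, QuotientGroup.eq] at h
  have h2 : U⁻¹ * V ∈ Subgroup.center (Matrix.GeneralLinearGroup (Fin 3) K) := h
  rw [Matrix.GeneralLinearGroup.mem_center_iff_val_mem_range_scalar] at h2
  obtain ⟨c, hc⟩ := h2
  refine ⟨c, ?_⟩
  have : (V : Matrix (Fin 3) (Fin 3) K) = U * ((U⁻¹ * V : GL3 K) : Matrix (Fin 3) (Fin 3) K) := by
    rw [← Units.val_mul, mul_inv_cancel_left]
  rw [this]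
  have hc' : ((U⁻¹ * V : GL3 K) : Matrix (Fin 3) (Fin 3) K) = Matrix.scalar (Fin 3) c := hc.symm
  rw [hc', Matrix.scalar_apply, ← Matrix.smul_one_eq_diagonal]
  simp

/-- The diagonal matrix `diag(1, ξ, ξ⁻¹)`. -/
def sigmaMat (ξ : K) : Matrix (Fin 3) (Fin 3) K :=
  !![1, 0, 0; 0, ξ, 0; 0, 0, ξ⁻¹]

/-- The matrix exchanging the last two coordinates. -/
def tauMat (K : Type*) [Field K] : Matrix (Fin 3) (Fin 3) K :=
  !![(1 : K), 0, 0; 0, 0, 1; 0, 1, 0]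

/-- The involution of the icosahedral group that does not fix the axis of the rotations
`diag(1, ξ, ξ⁻¹)`. -/
def rhoMat (s : K) : Matrix (Fin 3) (Fin 3) K :=
  !![1, 1, 1; 2, (-1 + s) / 2, (-1 - s) / 2; 2, (-1 - s) / 2, (-1 + s) / 2]

lemma sigmaMat_mulVec (ξ : K) (v : Fin 3 → K) :
    (sigmaMat ξ).mulVec v = ![v 0, ξ * v 1, ξ⁻¹ * v 2] := by
  ext i; fin_cases i <;> simp [sigmaMat, Matrix.mulVec, dotProduct, Fin.sum_univ_three]

lemma tauMat_mulVec (v : Fin 3 → K) : (tauMat K).mulVec v = ![v 0, v 2, v 1] := by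
  ext i; fin_cases i <;> simp [tauMat, Matrix.mulVec, dotProduct, Fin.sum_univ_three]

lemma rhoMat_mulVec (s : K) (v : Fin 3 → K) : (rhoMat s).mulVec v =
    ![v 0 + v 1 + v 2, 2 * v 0 + (-1 + s) / 2 * v 1 + (-1 - s) / 2 * v 2,
      2 * v 0 + (-1 - s) / 2 * v 1 + (-1 + s) / 2 * v 2] := by
  ext i; fin_cases i <;> simp [rhoMat, Matrix.mulVec, dotProduct, Fin.sum_univ_three]

lemma det_sigmaMat {ξ : K} (hξ : ξ ≠ 0) : (sigmaMat ξ).det = 1 := by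
  simp [sigmaMat, Matrix.det_fin_three, hξ]

lemma det_tauMat : (tauMat K).det = -1 := by
  simp [tauMat, Matrix.det_fin_three]

lemma det_rhoMat [CharZero K] (s : K) : (rhoMat s).det = -5 * s := by
  simp only [rhoMat, Matrix.det_fin_three, Matrix.of_apply, Matrix.cons_val]
  ring

lemma sigmaMat_pow (ξ : K) (n : ℕ) : sigmaMat ξ ^ n = sigmaMat (ξ ^ n) := by
  induction n with
  | zero => ext i j; fin_cases i <;> fin_cases j <;> simp [sigmaMat]
  | succ n ih =>
    rw [pow_succ, ih]
    ext i j; fin_cases i <;> fin_cases j <;>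
      simp [sigmaMat, Matrix.mul_apply, Fin.sum_univ_three, pow_succ, mul_comm]

/-- The matrices that preserve the invariant conic and a sextic of the pencil. -/
structure PreservesPencil (g : K) (A : Matrix (Fin 3) (Fin 3) K) : Prop where
  det_ne_zero : A.det ≠ 0
  exists_conic : ∃ d ≠ 0, ∀ v, conic (A.mulVec v) = d * conic v
  exists_sextic : ∃ c ≠ 0, ∀ v, eval (A.mulVec v) (pencil g) = c * eval v (pencil g)

lemma PreservesPencil.mul {g : K} {A B : Matrix (Fin 3) (Fin 3) K} (hA : PreservesPencil g A)
    (hB : PreservesPencil g B) : PreservesPencil g (A * B) := by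
  obtain ⟨hA, ⟨d, hd, hdA⟩, c, hc, hcA⟩ := hA
  obtain ⟨hB, ⟨e, he, heB⟩, f, hf, hfB⟩ := hB
  refine ⟨by rw [Matrix.det_mul]; exact mul_ne_zero hA hB, ⟨d * e, mul_ne_zero hd he, fun v => ?_⟩,
    c * f, mul_ne_zero hc hf, fun v => ?_⟩
  · rw [← Matrix.mulVec_mulVec, hdA, heB, mul_assoc]
  · rw [← Matrix.mulVec_mulVec, hcA, hfB, mul_assoc]

lemma PreservesPencil.one (g : K) : PreservesPencil g 1 :=
  ⟨by simp, ⟨1, one_ne_zero, by simp⟩, 1, one_ne_zero, by simp⟩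

lemma PreservesPencil.pow {g : K} {A : Matrix (Fin 3) (Fin 3) K} (hA : PreservesPencil g A)
    (n : ℕ) : PreservesPencil g (A ^ n) := by
  induction n with
  | zero => rw [pow_zero]; exact .one g
  | succ n ih => rw [pow_succ]; exact ih.mul hA

lemma PreservesPencil.inv {g : K} {A : Matrix (Fin 3) (Fin 3) K} (hA : PreservesPencil g A) :
    PreservesPencil g A⁻¹ := by
  obtain ⟨hA, ⟨d, hd, hdA⟩, c, hc, hcA⟩ := hA
  have h : ∀ v, A.mulVec (A⁻¹.mulVec v) = v := fun v => by
    rw [Matrix.mulVec_mulVec, Matrix.mul_nonsing_inv _ (isUnit_iff_ne_zero.2 hA),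
      Matrix.one_mulVec]
  refine ⟨?_, ⟨d⁻¹, inv_ne_zero hd, fun v => ?_⟩, c⁻¹, inv_ne_zero hc, fun v => ?_⟩
  · rw [Matrix.det_nonsing_inv]
    exact (isUnit_iff_ne_zero.2 hA).ringInverse.ne_zero
  · rw [eq_inv_mul_iff_mul_eq₀ hd, ← hdA, h]
  · rw [eq_inv_mul_iff_mul_eq₀ hc, ← hcA, h]

lemma preservesPencil_of_clebsch {g : K} {A : Matrix (Fin 3) (Fin 3) K} (hA : A.det ≠ 0) {d : K}
    (hd : d ≠ 0) (h : ∀ v, conic (A.mulVec v) = d * conic v)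
    (h' : ∀ v, clebsch (A.mulVec v) = d ^ 3 * clebsch v) : PreservesPencil g A :=
  ⟨hA, ⟨d, hd, h⟩, d ^ 3, pow_ne_zero _ hd, fun v => by
    rw [eval_pencil, eval_pencil, h, h']
    ring⟩

lemma preservesPencil_sigmaMat (g : K) {ξ : K} (hξ : ξ ^ 5 = 1) :
    PreservesPencil g (sigmaMat ξ) := by
  have h0 : ξ ≠ 0 := by rintro rfl; simp at hξ
  have h1 : ξ * ξ⁻¹ = 1 := mul_inv_cancel₀ h0
  have h2 : ξ⁻¹ ^ 5 = 1 := by rw [inv_pow, hξ, inv_one]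
  refine preservesPencil_of_clebsch (by simp [det_sigmaMat h0]) one_ne_zero (fun v => ?_)
    fun v => ?_
  · simp only [sigmaMat_mulVec, conic, Matrix.cons_val]
    linear_combination v 1 * v 2 * h1
  · simp only [sigmaMat_mulVec, clebsch, Matrix.cons_val]
    generalize ξ⁻¹ = η at h1 h2
    have h3 : (ξ * η) ^ 2 = 1 := by rw [h1, one_pow]
    have h4 : (ξ * η) ^ 3 = 1 := by rw [h1, one_pow]
    linear_combination v 0 * v 1 ^ 5 * hξ + v 0 * v 2 ^ 5 * h2 - 8 * v 0 ^ 4 * v 1 * v 2 * h1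
      + 2 * v 0 ^ 2 * v 1 ^ 2 * v 2 ^ 2 * h3 - v 1 ^ 3 * v 2 ^ 3 * h4

lemma preservesPencil_tauMat (g : K) : PreservesPencil g (tauMat K) := by
  refine preservesPencil_of_clebsch (by simp [det_tauMat]) one_ne_zero (fun v => ?_)
    fun v => ?_ <;> simp only [tauMat_mulVec, conic, clebsch, Matrix.cons_val] <;> ring

lemma preservesPencil_rhoMat [CharZero K] (g : K) {s : K} (hs : s ^ 2 = 5) :
    PreservesPencil g (rhoMat s) := by
  have hs0 : s ≠ 0 := by rintro rfl; norm_num at hs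
  obtain ⟨a, rfl⟩ : ∃ a, s = 2 * a + 1 := ⟨(s - 1) / 2, by ring⟩
  have ha : a ^ 2 = 1 - a := by linear_combination hs / 4
  have ha3 : a ^ 3 = 2 * a - 1 := by linear_combination (a - 1) * ha
  have ha4 : a ^ 4 = 2 - 3 * a := by linear_combination a * ha3 + 2 * ha
  have ha5 : a ^ 5 = 5 * a - 3 := by linear_combination a * ha4 - 3 * ha
  have ha6 : a ^ 6 = 5 - 8 * a := by linear_combination a * ha5 + 5 * ha
  have h1 : (-1 + (2 * a + 1)) / 2 = a := by ring
  have h2 : (-1 - (2 * a + 1)) / 2 = -1 - a := by ring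
  refine preservesPencil_of_clebsch (d := 5) (by simpa [det_rhoMat] using hs0) (by norm_num)
    (fun v => ?_) fun v => ?_ <;>
    simp only [rhoMat_mulVec, conic, clebsch, Matrix.cons_val, h1, h2] <;>
    generalize v 0 = x <;> generalize v 1 = y <;> generalize v 2 = z
  · linear_combination (- y ^ 2 + 2 * y * z - z ^ 2) * ha
  · ring_nf
    simp only [ha, ha3, ha4, ha5, ha6]
    ring

/-- Normal forms for the elements of the icosahedral group. -/
def wordMat (ζ s : K) (j : Fin 5) (e f : Fin 2) (k : Fin 5) : Matrix (Fin 3) (Fin 3) K :=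
  sigmaMat ζ ^ (j : ℕ) * rhoMat s ^ (e : ℕ) * tauMat K ^ (f : ℕ) * sigmaMat ζ ^ (k : ℕ)

lemma preservesPencil_wordMat [CharZero K] (g : K) {ζ s : K} (hζ : ζ ^ 5 = 1) (hs : s ^ 2 = 5)
    (j : Fin 5) (e f : Fin 2) (k : Fin 5) : PreservesPencil g (wordMat ζ s j e f k) :=
  ((((preservesPencil_sigmaMat g hζ).pow _).mul ((preservesPencil_rhoMat g hs).pow _)).mul
    ((preservesPencil_tauMat g).pow _)).mul ((preservesPencil_sigmaMat g hζ).pow _)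

lemma exists_fin_pow_eq {ζ : K} (hζ : IsPrimitiveRoot ζ 5) {w : K} (hw : w ^ 5 = 1) :
    ∃ j : Fin 5, w = ζ ^ (j : ℕ) := by
  obtain ⟨i, hi, h⟩ := hζ.eq_pow_of_pow_eq_one hw
  exact ⟨⟨i, hi⟩, h.symm⟩

lemma exists_fin_pow_mul_eq {ζ : K} (hζ : IsPrimitiveRoot ζ 5) {w a : K} (ha : a ≠ 0)
    (hw : w ^ 5 = a ^ 5) : ∃ j : Fin 5, w = ζ ^ (j : ℕ) * a := by
  obtain ⟨j, hj⟩ := exists_fin_pow_eq hζ (w := w / a) (by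
    rw [div_pow, hw, div_self (pow_ne_zero _ ha)])
  exact ⟨j, by rw [← hj, div_mul_cancel₀ _ ha]⟩

/-- The twelve common zeros of the invariant conic and the Clebsch sextic form one orbit. -/
lemma exists_wordMat_mulVec [CharZero K] {ζ s : K} (hζ : IsPrimitiveRoot ζ 5) (hs : s ^ 2 = 5)
    {v : Fin 3 → K} (hv : v ≠ 0) (h : conic v = 0) (h' : clebsch v = 0) :
    ∃ (j : Fin 5) (e f : Fin 2) (μ : K), (e = 0 → j = 0) ∧
      (wordMat ζ s j e f 0).mulVec ![0, 1, 0] = μ • v := by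
  have hζ0 : ζ ≠ 0 := hζ.ne_zero (by norm_num)
  by_cases hx : v 0 = 0
  · have hyz : v 1 * v 2 = 0 := by simpa [conic, hx] using h
    rcases mul_eq_zero.1 hyz with hy | hz
    · have hz : v 2 ≠ 0 := fun hz => hv (by ext i; fin_cases i <;> simpa)
      refine ⟨0, 0, 1, (v 2)⁻¹, fun _ => rfl, ?_⟩
      ext i; fin_cases i <;> simp [wordMat, tauMat_mulVec, hx, hy, hz]
    · have hy : v 1 ≠ 0 := fun hy => hv (by ext i; fin_cases i <;> simpa)
      refine ⟨0, 0, 0, (v 1)⁻¹, fun _ => rfl, ?_⟩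
      ext i; fin_cases i <;> simp [wordMat, hx, hy, hz]
  obtain ⟨y, hy⟩ : ∃ y, v 1 = v 0 * y := ⟨v 1 / v 0, by field_simp⟩
  obtain ⟨z, hz⟩ : ∃ z, v 2 = v 0 * z := ⟨v 2 / v 0, by field_simp⟩
  have hyz : y * z = -1 := by
    have : v 0 ^ 2 * (y * z + 1) = 0 := by
      rw [← h, conic, hy, hz]
      ring
    linear_combination (mul_eq_zero.1 this).resolve_left (pow_ne_zero _ hx)
  have hy0 : y ≠ 0 := by rintro rfl; simp at hyz
  have hz' : z = -y⁻¹ := by field_simp; linear_combination hyz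
  set a : K := (-1 + s) / 2 with ha
  set b : K := (-1 - s) / 2 with hb
  have hab : a * b = -1 := by rw [ha, hb]; linear_combination -hs / 4
  have ha0 : a ≠ 0 := by intro h; simp [h] at hab
  have hb0 : b ≠ 0 := by intro h; simp [h] at hab
  have hab1 : a + b = -1 := by rw [ha, hb]; ring
  have hy5 : (y ^ 5 - a ^ 5) * (y ^ 5 - b ^ 5) = 0 := by
    have h5 : y ^ 5 + z ^ 5 + 11 = 0 := by
      have : v 0 ^ 6 * (y ^ 5 + z ^ 5 + 11) = 0 := by
        rw [← h', clebsch, hy, hz]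
        linear_combination v 0 ^ 6 * (8 - 2 * (y * z - 1) + ((y * z) ^ 2 - y * z + 1)) * hyz
      exact (mul_eq_zero.1 this).resolve_left (pow_ne_zero _ hx)
    have hyz5 : y ^ 5 * z ^ 5 = -1 := by rw [← mul_pow, hyz]; norm_num
    have hab5 : a ^ 5 * b ^ 5 = -1 := by rw [← mul_pow, hab]; norm_num
    have hs5 : a ^ 5 + b ^ 5 = -11 := by
      rw [ha, hb]
      linear_combination (-5 * s ^ 2 / 16 - 10 / 16 - 25 / 16) * hs
    linear_combination y ^ 5 * h5 - hyz5 + hab5 - y ^ 5 * hs5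
  have key : ∀ (w u : K), w ≠ 0 → w * u = -1 → y ^ 5 = w ^ 5 →
      ∃ j : Fin 5, ![1, ζ ^ (j : ℕ) * w, (ζ ^ (j : ℕ))⁻¹ * u] = (v 0)⁻¹ • v := by
    intro w u hw hwu h
    obtain ⟨j, hj⟩ := exists_fin_pow_mul_eq hζ hw h
    have hu : u = -w⁻¹ := by field_simp; linear_combination hwu
    refine ⟨j, ?_⟩
    have hz2 : z = (ζ ^ (j : ℕ))⁻¹ * u := by
      rw [hz', hj, hu, mul_inv]
      ring
    rw [← hj, ← hz2]
    ext i; fin_cases i <;> simp [hx, hy, hz]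
  rcases mul_eq_zero.1 hy5 with h5 | h5
  · obtain ⟨j, hj⟩ := key a b ha0 hab (sub_eq_zero.1 h5)
    refine ⟨j, 1, 0, (v 0)⁻¹, fun h => absurd h (by decide), ?_⟩
    rw [← hj]
    simp [wordMat, sigmaMat_pow, ← Matrix.mulVec_mulVec, rhoMat_mulVec, sigmaMat_mulVec, ha, hb]
  · obtain ⟨j, hj⟩ := key b a hb0 (by rw [mul_comm, hab]) (sub_eq_zero.1 h5)
    refine ⟨j, 1, 1, (v 0)⁻¹, fun h => absurd h (by decide), ?_⟩
    rw [← hj]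
    simp [wordMat, sigmaMat_pow, ← Matrix.mulVec_mulVec, rhoMat_mulVec, sigmaMat_mulVec,
      tauMat_mulVec, ha, hb]

/-- The stabilizer of the point `(0 : 1 : 0)`. -/
lemma PreservesPencil.eq_sigmaMat_of_col [CharZero K] {ζ g : K} (hζ : IsPrimitiveRoot ζ 5)
    (hg : g ≠ 0) {B : Matrix (Fin 3) (Fin 3) K} (hB : PreservesPencil g B)
    (h0 : B 0 1 = 0) (h2 : B 2 1 = 0) : ∃ (k : Fin 5) (μ : K), B = μ • sigmaMat ζ ^ (k : ℕ) := by
  obtain ⟨-, ⟨d, hd, hdB⟩, c, -, hcB⟩ := hB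
  have hmul : ∀ v, B.mulVec v = ![B 0 0 * v 0 + B 0 2 * v 2,
      B 1 0 * v 0 + B 1 1 * v 1 + B 1 2 * v 2, B 2 0 * v 0 + B 2 2 * v 2] := fun v => by
    ext i; fin_cases i <;> simp [Matrix.mulVec, dotProduct, Fin.sum_univ_three, h0, h2]
  simp only [hmul, eval_pencil] at hcB
  simp only [hmul] at hdB
  have hd' := fun x y z => hdB ![x, y, z]
  have hc' := fun x y z => hcB ![x, y, z]
  simp only [conic, clebsch, Matrix.cons_val] at hd' hc'
  clear hcB hdB
  generalize ha : B 0 0 = a at *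
  generalize hb : B 0 2 = b at *
  generalize hp : B 1 0 = p at *
  generalize he : B 1 1 = e at *
  generalize hf : B 1 2 = f at *
  generalize hr : B 2 0 = r at *
  generalize hh : B 2 2 = h at *
  have e1 := hd' 1 0 0
  have e2 := hd' 0 0 1
  have eh : e * h = d := by linear_combination hd' 0 1 1 - e2
  have er : e * r = 0 := by linear_combination hd' 1 1 0 - e1
  have he0 : e ≠ 0 := by rintro rfl; apply hd; rw [← eh, zero_mul]
  have hh0 : h ≠ 0 := by rintro rfl; apply hd; rw [← eh, mul_zero]
  obtain rfl : r = 0 := (mul_eq_zero.1 er).resolve_left he0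
  have a2 : a ^ 2 = d := by linear_combination e1
  have hb5 : g * (b * e ^ 5) = 0 := by
    linear_combination (hc' 0 5 1 - 5 * hc' 0 4 1 + 10 * hc' 0 3 1 - 10 * hc' 0 2 1
      + 5 * hc' 0 1 1 - hc' 0 0 1) / 120
  obtain rfl : b = 0 := by
    rcases mul_eq_zero.1 ((mul_eq_zero.1 hb5).resolve_left hg) with h | h
    · exact h
    · exact absurd h (pow_ne_zero _ he0)
  obtain rfl : f = 0 := by
    have : f * h = 0 := by linear_combination e2
    exact (mul_eq_zero.1 this).resolve_right hh0
  obtain rfl : p = 0 := by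
    have : p * h = 0 := by linear_combination hd' 1 0 1 - e1 - e2
    exact (mul_eq_zero.1 this).resolve_right hh0
  have ha0 : a ≠ 0 := by rintro rfl; apply hd; rw [← a2]; norm_num
  have c1 : c = a ^ 6 := by linear_combination -hc' 1 0 0 / 32
  have e5 : e ^ 5 = a ^ 5 := by
    have : g * a * (e ^ 5 - a ^ 5) = 0 := by
      linear_combination hc' 1 1 0 + (32 + g) * c1
    linear_combination (mul_eq_zero.1 this).resolve_left (mul_ne_zero hg ha0)
  obtain ⟨k, hk⟩ := exists_fin_pow_mul_eq hζ ha0 e5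
  have hζ0 : ζ ^ (k : ℕ) ≠ 0 := pow_ne_zero _ (hζ.ne_zero (by norm_num))
  have hh' : h = a * (ζ ^ (k : ℕ))⁻¹ := by
    rw [eq_mul_inv_iff_mul_eq₀ hζ0]
    apply mul_left_cancel₀ ha0
    linear_combination eh - a2 - h * hk
  refine ⟨k, a, ?_⟩
  rw [sigmaMat_pow]
  ext i j
  fin_cases i <;> fin_cases j <;> simp [sigmaMat, *, mul_comm]

lemma PreservesPencil.exists_eq_wordMat [CharZero K] {ζ s g : K} (hζ : IsPrimitiveRoot ζ 5)
    (hs : s ^ 2 = 5) (hg : g ≠ 0) {A : Matrix (Fin 3) (Fin 3) K} (hA : PreservesPencil g A) :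
    ∃ (j : Fin 5) (e f : Fin 2) (k : Fin 5), (e = 0 → j = 0) ∧
      pgl A = pgl (wordMat ζ s j e f k) := by
  obtain ⟨d, hd, hdA⟩ := hA.exists_conic
  obtain ⟨c, hc, hcA⟩ := hA.exists_sextic
  set v := A.mulVec ![0, 1, 0] with hv
  have hAinv : A⁻¹ * A = 1 := Matrix.nonsing_inv_mul _ (isUnit_iff_ne_zero.2 hA.det_ne_zero)
  have hv0 : v ≠ 0 := by
    intro h
    have : A⁻¹.mulVec v = ![0, 1, 0] := by rw [hv, Matrix.mulVec_mulVec, hAinv, Matrix.one_mulVec]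
    rw [h, Matrix.mulVec_zero] at this
    simpa using congrFun this 1
  have h1 : conic v = 0 := by rw [hv, hdA]; simp [conic]
  have h2 : clebsch v = 0 := by
    have := hcA ![0, 1, 0]
    rw [← hv, eval_pencil, eval_pencil, h1] at this
    simpa [conic, clebsch, hg] using this
  obtain ⟨j, e, f, μ, hj, hW⟩ := exists_wordMat_mulVec hζ hs hv0 h1 h2
  have hWp := preservesPencil_wordMat g hζ.pow_eq_one hs j e f 0
  set W := wordMat ζ s j e f 0 with hWdef
  have hWW : W * W⁻¹ = 1 := Matrix.mul_nonsing_inv _ (isUnit_iff_ne_zero.2 hWp.det_ne_zero)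
  have hWW' : W⁻¹ * W = 1 := Matrix.nonsing_inv_mul _ (isUnit_iff_ne_zero.2 hWp.det_ne_zero)
  have hB := hWp.inv.mul hA
  have hBcol : μ • (W⁻¹ * A).mulVec ![0, 1, 0] = ![0, 1, 0] := by
    rw [← Matrix.mulVec_mulVec, ← hv, ← Matrix.mulVec_smul, ← hW, Matrix.mulVec_mulVec, hWW',
      Matrix.one_mulVec]
  have hμ : μ ≠ 0 := by
    rintro rfl
    simpa using congrFun hBcol 1
  have hcol : ∀ i, (W⁻¹ * A).mulVec ![0, 1, 0] i = (W⁻¹ * A) i 1 := fun i => by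
    simp [Matrix.mulVec, dotProduct, Fin.sum_univ_three]
  have h0 : (W⁻¹ * A) 0 1 = 0 := by
    have := congrFun hBcol 0
    rw [Pi.smul_apply, hcol] at this
    simpa [hμ] using this
  have h2 : (W⁻¹ * A) 2 1 = 0 := by
    have := congrFun hBcol 2
    rw [Pi.smul_apply, hcol] at this
    simpa [hμ] using this
  obtain ⟨k, ν, hk⟩ := hB.eq_sigmaMat_of_col hζ hg h0 h2
  have hν : ν ≠ 0 := by
    rintro rfl
    apply hB.det_ne_zero
    simp [hk]
  refine ⟨j, e, f, k, hj, ?_⟩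
  have hA' : A = ν • wordMat ζ s j e f k := by
    calc A = W * (W⁻¹ * A) := by rw [← mul_assoc, hWW, one_mul]
      _ = _ := by rw [hk, hWdef]; simp [wordMat]
  rw [hA', pgl_smul hν (preservesPencil_wordMat g hζ.pow_eq_one hs j e f k).det_ne_zero]

lemma PreservesPencil.pgl_mem_planeAut [Infinite K] {g : K} {A : Matrix (Fin 3) (Fin 3) K}
    (hA : PreservesPencil g A) : pgl A ∈ planeAut (pencil g) := by
  obtain ⟨c, hc, h⟩ := hA.exists_sextic
  obtain ⟨U, rfl⟩ := exists_unit_of_det_ne_zero hA.det_ne_zero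
  exact ⟨U, (pgl_unit U).symm, c, hc, (matAct_eq_smul_iff _ _ _).2 h⟩

lemma exists_preservesPencil_of_mem_planeAut [CharZero K] {g : K} (hg : g ≠ 0)
    (hw : g ^ 2 - 9 * g + 864 ≠ 0) {x : PGL3 K} (hx : x ∈ planeAut (pencil g)) :
    ∃ A, PreservesPencil g A ∧ pgl A = x := by
  obtain ⟨U, rfl, c, hc, h⟩ := hx
  exact ⟨U, ⟨det_unit_ne_zero U, conic_mulVec hg hw (det_unit_ne_zero U) h, c, hc,
    (matAct_eq_smul_iff _ _ _).1 h⟩, pgl_unit U⟩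

/-- The five cubics that are permuted by the icosahedral group. -/
def cubic (ζ : K) (i : Fin 5) (v : Fin 3 → K) : K :=
  (ζ ^ ((-i : Fin 5) : ℕ) * v 1 - ζ ^ (i : ℕ) * v 2) *
    (4 * v 0 ^ 2 - 2 * v 0 * (ζ ^ ((-i : Fin 5) : ℕ) * v 1 + ζ ^ (i : ℕ) * v 2)
      - (ζ ^ ((-i : Fin 5) : ℕ) * v 1 + ζ ^ (i : ℕ) * v 2) ^ 2)

lemma cubic_smul (ζ : K) (i : Fin 5) (μ : K) (v : Fin 3 → K) :
    cubic ζ i (μ • v) = μ ^ 3 * cubic ζ i v := by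
  simp only [cubic, Pi.smul_apply, smul_eq_mul]
  ring

lemma cubic_injective [CharZero K] {ζ : K} (hζ : IsPrimitiveRoot ζ 5) {i j : Fin 5} {c : K}
    (h : ∀ v, cubic ζ i v = c * cubic ζ j v) : i = j := by
  have hi : ζ ^ ((-i : Fin 5) : ℕ) ≠ 0 := pow_ne_zero _ (hζ.ne_zero (by norm_num))
  have key : ζ ^ ((-i : Fin 5) : ℕ) = ζ ^ ((-j : Fin 5) : ℕ) := by
    have h0 := h ![0, 1, 0]
    have h1 := h ![1, 1, 0]
    have h2 := h ![-1, 1, 0]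
    simp only [cubic, Matrix.cons_val] at h0 h1 h2
    generalize ζ ^ ((-i : Fin 5) : ℕ) = p at *
    generalize ζ ^ ((-j : Fin 5) : ℕ) = q at *
    have e1 : p = c * q := by linear_combination (h1 + h2 - 2 * h0) / 8
    have e2 : p ^ 2 = c * q ^ 2 := by linear_combination (h2 - h1) / 4
    apply mul_left_cancel₀ hi
    linear_combination e2 - q * e1
  have := hζ.pow_inj (-i : Fin 5).2 (-j : Fin 5).2 key
  exact neg_injective (Fin.ext this)

/-- The matrices that permute the five cubics up to scalars, by a given permutation. -/
structure PermutesCubics (ζ : K) (A : Matrix (Fin 3) (Fin 3) K) (π : Equiv.Perm (Fin 5)) :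
    Prop where
  det_ne_zero : A.det ≠ 0
  exists_cubic : ∀ i, ∃ c ≠ 0, ∀ v, cubic ζ (π i) (A.mulVec v) = c * cubic ζ i v

lemma PermutesCubics.mul {ζ : K} {A B : Matrix (Fin 3) (Fin 3) K} {π ρ : Equiv.Perm (Fin 5)}
    (hA : PermutesCubics ζ A π) (hB : PermutesCubics ζ B ρ) :
    PermutesCubics ζ (A * B) (π * ρ) := by
  refine ⟨by rw [Matrix.det_mul]; exact mul_ne_zero hA.1 hB.1, fun i => ?_⟩
  obtain ⟨c, hc, h⟩ := hB.2 i
  obtain ⟨d, hd, h'⟩ := hA.2 (ρ i)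
  refine ⟨d * c, mul_ne_zero hd hc, fun v => ?_⟩
  rw [← Matrix.mulVec_mulVec, Equiv.Perm.mul_apply, h', h, mul_assoc]

lemma PermutesCubics.one (ζ : K) : PermutesCubics ζ 1 1 :=
  ⟨by simp, fun _ => ⟨1, one_ne_zero, by simp⟩⟩

lemma PermutesCubics.pow {ζ : K} {A : Matrix (Fin 3) (Fin 3) K} {π : Equiv.Perm (Fin 5)}
    (hA : PermutesCubics ζ A π) (n : ℕ) : PermutesCubics ζ (A ^ n) (π ^ n) := by
  induction n with
  | zero => rw [pow_zero, pow_zero]; exact .one ζ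
  | succ n ih => rw [pow_succ, pow_succ]; exact ih.mul hA

lemma PermutesCubics.unique [CharZero K] {ζ : K} (hζ : IsPrimitiveRoot ζ 5)
    {A B : Matrix (Fin 3) (Fin 3) K} {π ρ : Equiv.Perm (Fin 5)} (hA : PermutesCubics ζ A π)
    (hB : PermutesCubics ζ B ρ) (hAB : pgl A = pgl B) : π = ρ := by
  obtain ⟨μ, rfl⟩ := exists_smul_of_pgl_eq hA.1 hB.1 hAB
  have hμ : μ ^ 3 ≠ 0 := by
    intro h
    apply hB.1
    rw [Matrix.det_smul, Fintype.card_fin, h, zero_mul]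
  ext1 i
  obtain ⟨c, hc, h⟩ := hA.2 i
  obtain ⟨d, hd, h'⟩ := hB.2 i
  refine cubic_injective hζ (c := c * μ ^ 3 / d) fun w => ?_
  have hw : A.mulVec (A⁻¹.mulVec w) = w := by
    rw [Matrix.mulVec_mulVec, Matrix.mul_nonsing_inv _ (isUnit_iff_ne_zero.2 hA.1),
      Matrix.one_mulVec]
  have h1 := h (A⁻¹.mulVec w)
  have h2 := h' (A⁻¹.mulVec w)
  rw [Matrix.smul_mulVec, cubic_smul, hw] at h2
  rw [hw] at h1
  rw [h1]
  field_simp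
  linear_combination -h2

/-- The permutation of the five cubics induced by `sigmaMat ζ`. -/
def sigmaPerm : Equiv.Perm (Fin 5) := Equiv.addRight 1

/-- The permutation of the five cubics induced by `tauMat K`. -/
def tauPerm : Equiv.Perm (Fin 5) := Equiv.neg (Fin 5)

/-- The permutation of the five cubics induced by `rhoMat s`. -/
def rhoPerm : Equiv.Perm (Fin 5) := Equiv.swap 1 3 * Equiv.swap 2 4

lemma permutesCubics_sigmaMat {ζ : K} (hζ : ζ ^ 5 = 1) :
    PermutesCubics ζ (sigmaMat ζ) sigmaPerm := by
  have h0 : ζ ≠ 0 := by rintro rfl; simp at hζ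
  refine ⟨by simp [det_sigmaMat h0], fun i => ⟨1, one_ne_zero, fun v => ?_⟩⟩
  have h1 : ζ ^ ((-(i + 1) : Fin 5) : ℕ) * ζ = ζ ^ ((-i : Fin 5) : ℕ) := by
    rw [← pow_succ]
    have h : ∀ i : Fin 5, ((-(i + 1) : Fin 5) : ℕ) + 1 = ((-i : Fin 5) : ℕ) ∨
        ((-(i + 1) : Fin 5) : ℕ) + 1 = ((-i : Fin 5) : ℕ) + 5 := by decide
    rcases h i with h | h
    · rw [h]
    · rw [h, pow_add, hζ, mul_one]
  have h2 : ζ ^ ((i + 1 : Fin 5) : ℕ) * ζ⁻¹ = ζ ^ (i : ℕ) := by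
    rw [mul_inv_eq_iff_eq_mul₀ h0, ← pow_succ]
    have h : ∀ i : Fin 5, (i : ℕ) + 1 = ((i + 1 : Fin 5) : ℕ) ∨
        (i : ℕ) + 1 = ((i + 1 : Fin 5) : ℕ) + 5 := by decide
    rcases h i with h | h
    · rw [h]
    · rw [h, pow_add, hζ, mul_one]
  simp only [sigmaMat_mulVec, cubic, sigmaPerm, Equiv.coe_addRight, Matrix.cons_val,
    ← mul_assoc, h1, h2, one_mul]

lemma permutesCubics_tauMat (ζ : K) : PermutesCubics ζ (tauMat K) tauPerm := by
  refine ⟨by simp [det_tauMat], fun i => ⟨-1, by simp, fun v => ?_⟩⟩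
  simp only [tauMat_mulVec, cubic, tauPerm, Equiv.neg_apply, Matrix.cons_val, neg_neg]
  ring

set_option maxRecDepth 4000 in
lemma permutesCubics_rhoMat [CharZero K] {ζ s : K} (hζ : ζ ^ 4 + ζ ^ 3 + ζ ^ 2 + ζ + 1 = 0)
    (hs : s = 1 + 2 * (ζ + ζ ^ 4)) (hs0 : s ≠ 0) : PermutesCubics ζ (rhoMat s) rhoPerm := by
  have h1 : (-1 + s) / 2 = -(1 + ζ ^ 2 + ζ ^ 3) := by linear_combination hs / 2 + hζ
  have h2 : (-1 - s) / 2 = ζ ^ 2 + ζ ^ 3 := by linear_combination -hs / 2 - hζ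
  have h3 : s = -1 - 2 * (ζ ^ 2 + ζ ^ 3) := by linear_combination hs + 2 * hζ
  have h4 : ζ ^ 4 = -1 - ζ - ζ ^ 2 - ζ ^ 3 := by linear_combination hζ
  have h5 : ζ ^ 5 = 1 := by linear_combination (ζ - 1) * hζ
  have h6 : ζ ^ 6 = ζ := by linear_combination ζ * h5
  have h7 : ζ ^ 7 = ζ ^ 2 := by linear_combination ζ ^ 2 * h5
  have h8 : ζ ^ 8 = ζ ^ 3 := by linear_combination ζ ^ 3 * h5
  have h9 : ζ ^ 9 = -1 - ζ - ζ ^ 2 - ζ ^ 3 := by linear_combination ζ ^ 4 * h5 + h4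
  have h10 : ζ ^ 10 = 1 := by linear_combination ζ ^ 5 * h5 + h5
  have h11 : ζ ^ 11 = ζ := by linear_combination ζ * h10
  have h12 : ζ ^ 12 = ζ ^ 2 := by linear_combination ζ ^ 2 * h10
  have h13 : ζ ^ 13 = ζ ^ 3 := by linear_combination ζ ^ 3 * h10
  have h14 : ζ ^ 14 = -1 - ζ - ζ ^ 2 - ζ ^ 3 := by linear_combination ζ ^ 4 * h10 + h4
  have h15 : ζ ^ 15 = 1 := by linear_combination ζ ^ 5 * h10 + h5
  have h16 : ζ ^ 16 = ζ := by linear_combination ζ * h15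
  have h17 : ζ ^ 17 = ζ ^ 2 := by linear_combination ζ ^ 2 * h15
  have h18 : ζ ^ 18 = ζ ^ 3 := by linear_combination ζ ^ 3 * h15
  have h19 : ζ ^ 19 = -1 - ζ - ζ ^ 2 - ζ ^ 3 := by linear_combination ζ ^ 4 * h15 + h4
  have h20 : ζ ^ 20 = 1 := by linear_combination ζ ^ 5 * h15 + h5
  have h21 : ζ ^ 21 = ζ := by linear_combination ζ * h20
  have hρ : rhoPerm 0 = 0 ∧ rhoPerm 1 = 3 ∧ rhoPerm 2 = 4 ∧ rhoPerm 3 = 1 ∧ rhoPerm 4 = 2 := by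
    decide
  have hn : (-(1 : Fin 5) = 4) ∧ (-(2 : Fin 5) = 3) ∧ (-(3 : Fin 5) = 2) ∧ (-(4 : Fin 5) = 1) := by
    decide
  obtain ⟨r0, r1, r2, r3, r4⟩ := hρ
  obtain ⟨n1, n2, n3, n4⟩ := hn
  refine ⟨by simpa [det_rhoMat] using hs0, fun i => ⟨-5 * s, by simpa using hs0, fun v => ?_⟩⟩
  simp only [rhoMat_mulVec, cubic, Matrix.cons_val, h1, h2]
  rw [h3]
  generalize v 0 = x
  generalize v 1 = y
  generalize v 2 = z
  clear hs h1 h2 h3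
  fin_cases i <;>
    simp only [Fin.zero_eta, Fin.mk_one, Fin.reduceFinMk, r0, r1, r2, r3, r4, n1, n2, n3, n4,
      neg_zero, Fin.coe_ofNat_eq_mod, Nat.reduceMod, pow_zero, pow_one] <;>
    ring_nf <;>
    simp only [h4, h5, h6, h7, h8, h9, h10, h11, h12, h13, h14, h15, h16, h17, h18, h19, h20,
      h21] <;>
    ring

/-- The permutation of the five cubics induced by `wordMat ζ s j e f k`. -/
def wordPerm (j : Fin 5) (e f : Fin 2) (k : Fin 5) : Equiv.Perm (Fin 5) :=
  sigmaPerm ^ (j : ℕ) * rhoPerm ^ (e : ℕ) * tauPerm ^ (f : ℕ) * sigmaPerm ^ (k : ℕ)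

lemma sign_wordPerm (j : Fin 5) (e f : Fin 2) (k : Fin 5) :
    Equiv.Perm.sign (wordPerm j e f k) = 1 := by
  have h1 : Equiv.Perm.sign sigmaPerm = 1 := by decide
  have h2 : Equiv.Perm.sign rhoPerm = 1 := by decide
  have h3 : Equiv.Perm.sign tauPerm = 1 := by decide
  simp [wordPerm, h1, h2, h3]

lemma eq_zero_of_wordPerm_eq_one : ∀ (j : Fin 5) (e f : Fin 2) (k : Fin 5), (e = 0 → j = 0) →
    wordPerm j e f k = 1 → j = 0 ∧ e = 0 ∧ f = 0 ∧ k = 0 := by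
  decide

lemma exists_wordPerm_eq : ∀ π : Equiv.Perm (Fin 5), Equiv.Perm.sign π = 1 →
    ∃ (j : Fin 5) (e f : Fin 2) (k : Fin 5), wordPerm j e f k = π := by
  decide +kernel

lemma permutesCubics_wordMat [CharZero K] {ζ s : K} (hζ : ζ ^ 4 + ζ ^ 3 + ζ ^ 2 + ζ + 1 = 0)
    (hs : s = 1 + 2 * (ζ + ζ ^ 4)) (hs0 : s ≠ 0) (j : Fin 5) (e f : Fin 2) (k : Fin 5) :
    PermutesCubics ζ (wordMat ζ s j e f k) (wordPerm j e f k) := by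
  have h5 : ζ ^ 5 = 1 := by linear_combination (ζ - 1) * hζ
  exact ((((permutesCubics_sigmaMat h5).pow _).mul ((permutesCubics_rhoMat hζ hs hs0).pow _)).mul
    ((permutesCubics_tauMat ζ).pow _)).mul ((permutesCubics_sigmaMat h5).pow _)

lemma IsPrimitiveRoot.cyclotomic_five_eq_zero {ζ : K} (hζ : IsPrimitiveRoot ζ 5) :
    ζ ^ 4 + ζ ^ 3 + ζ ^ 2 + ζ + 1 = 0 := by
  have h := hζ.geom_sum_eq_zero (by norm_num)
  simp only [Finset.sum_range_succ, Finset.sum_range_zero] at h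
  linear_combination h

/-- A primitive fifth root of unity adapted to a given square root of `5`. -/
lemma exists_isPrimitiveRoot_five {ζ s : K} (hζ : IsPrimitiveRoot ζ 5) (hs : s ^ 2 = 5) :
    ∃ η : K, IsPrimitiveRoot η 5 ∧ s = 1 + 2 * (η + η ^ 4) := by
  have h4 := hζ.cyclotomic_five_eq_zero
  have h : (s - (1 + 2 * (ζ + ζ ^ 4))) * (s - (1 + 2 * (ζ ^ 2 + (ζ ^ 2) ^ 4))) = 0 := by
    linear_combination hs + (2 * (1 - s) * (1 + ζ ^ 4 - ζ ^ 3)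
      + 4 * (1 + (ζ - 1) * (ζ + ζ ^ 2 + ζ ^ 4 + ζ ^ 7))) * h4
  rcases mul_eq_zero.1 h with h | h
  · exact ⟨ζ, hζ, sub_eq_zero.1 h⟩
  · exact ⟨ζ ^ 2, hζ.pow_of_coprime 2 (by norm_num), sub_eq_zero.1 h⟩

lemma nonempty_planeAut_mulEquiv [CharZero K] {ζ s g : K} (hζ : IsPrimitiveRoot ζ 5)
    (hs : s ^ 2 = 5) (hg : g ≠ 0) (hw : g ^ 2 - 9 * g + 864 ≠ 0) :
    Nonempty (planeAut (pencil g) ≃* alternatingGroup (Fin 5)) := by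
  obtain ⟨η, hη, hsη⟩ := exists_isPrimitiveRoot_five hζ hs
  have hs0 : s ≠ 0 := by rintro rfl; norm_num at hs
  have hword := permutesCubics_wordMat hη.cyclotomic_five_eq_zero hsη hs0
  have hex : ∀ x : planeAut (pencil g), ∃ (j : Fin 5) (e f : Fin 2) (k : Fin 5),
      (e = 0 → j = 0) ∧ pgl (wordMat η s j e f k) = (x : PGL3 K) := fun x => by
    obtain ⟨A, hA, hAx⟩ := exists_preservesPencil_of_mem_planeAut hg hw x.2
    obtain ⟨j, e, f, k, h, hjk⟩ := hA.exists_eq_wordMat hη hs hg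
    exact ⟨j, e, f, k, h, by rw [← hjk, hAx]⟩
  choose j e f k hj hx using hex
  have hmul : ∀ x y, wordPerm (j (x * y)) (e (x * y)) (f (x * y)) (k (x * y)) =
      wordPerm (j x) (e x) (f x) (k x) * wordPerm (j y) (e y) (f y) (k y) := fun x y => by
    refine (hword _ _ _ _).unique hη ((hword _ _ _ _).mul (hword _ _ _ _)) ?_
    rw [pgl_mul (hword _ _ _ _).1 (hword _ _ _ _).1, hx, hx, hx, Subgroup.coe_mul]
  let φ : planeAut (pencil g) →* alternatingGroup (Fin 5) :=
    MonoidHom.mk' (fun x => ⟨wordPerm (j x) (e x) (f x) (k x),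
      Equiv.Perm.mem_alternatingGroup.2 (sign_wordPerm _ _ _ _)⟩) fun x y =>
        Subtype.ext (hmul x y)
  refine ⟨MulEquiv.ofBijective φ ⟨(injective_iff_map_eq_one φ).2 fun x h => ?_, fun π => ?_⟩⟩
  · obtain ⟨h1, h2, h3, h4⟩ := eq_zero_of_wordPerm_eq_one _ _ _ _ (hj x) (congrArg Subtype.val h)
    apply Subtype.ext
    rw [← hx, h1, h2, h3, h4]
    simp [wordMat, pgl_one]
  · obtain ⟨j₁, e₁, f₁, k₁, h⟩ := exists_wordPerm_eq π (Equiv.Perm.mem_alternatingGroup.1 π.2)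
    refine ⟨⟨_, (preservesPencil_wordMat g hη.pow_eq_one hs j₁ e₁ f₁ k₁).pgl_mem_planeAut⟩,
      Subtype.ext ?_⟩
    rw [← h]
    exact (hword _ _ _ _).unique hη (hword _ _ _ _) (hx _)

lemma planeAut_pencil_eq_closure [CharZero K] {ζ s g : K} (hζ : IsPrimitiveRoot ζ 5)
    (hs : s ^ 2 = 5) (hg : g ≠ 0) (hw : g ^ 2 - 9 * g + 864 ≠ 0) :
    planeAut (pencil g) =
      Subgroup.closure {pgl (sigmaMat ζ), pgl (tauMat K), pgl (rhoMat s)} := by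
  have h1 := preservesPencil_sigmaMat g hζ.pow_eq_one
  have h2 := preservesPencil_tauMat g (K := K)
  have h3 := preservesPencil_rhoMat g hs
  apply le_antisymm
  · intro x hx
    obtain ⟨A, hA, rfl⟩ := exists_preservesPencil_of_mem_planeAut hg hw hx
    obtain ⟨j, e, f, k, -, h⟩ := hA.exists_eq_wordMat hζ hs hg
    rw [h, wordMat, pgl_mul (((h1.pow _).mul (h3.pow _)).mul (h2.pow _)).det_ne_zero
        (h1.pow _).det_ne_zero,
      pgl_mul ((h1.pow _).mul (h3.pow _)).det_ne_zero (h2.pow _).det_ne_zero,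
      pgl_mul (h1.pow _).det_ne_zero (h3.pow _).det_ne_zero,
      pgl_pow h1.det_ne_zero, pgl_pow h2.det_ne_zero, pgl_pow h3.det_ne_zero,
      pgl_pow h1.det_ne_zero]
    have m1 : pgl (sigmaMat ζ) ∈
      Subgroup.closure {pgl (sigmaMat ζ), pgl (tauMat K), pgl (rhoMat s)} :=
      Subgroup.subset_closure (by simp)
    have m2 : pgl (tauMat K) ∈
      Subgroup.closure {pgl (sigmaMat ζ), pgl (tauMat K), pgl (rhoMat s)} :=
      Subgroup.subset_closure (by simp)
    have m3 : pgl (rhoMat s) ∈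
      Subgroup.closure {pgl (sigmaMat ζ), pgl (tauMat K), pgl (rhoMat s)} :=
      Subgroup.subset_closure (by simp)
    exact mul_mem (mul_mem (mul_mem (pow_mem m1 _) (pow_mem m3 _)) (pow_mem m2 _)) (pow_mem m1 _)
  · rw [Subgroup.closure_le]
    rintro x (rfl | rfl | rfl)
    exacts [h1.pgl_mem_planeAut, h2.pgl_mem_planeAut, h3.pgl_mem_planeAut]

lemma card_alternatingGroup_five : Nat.card (alternatingGroup (Fin 5)) = 60 := by
  rw [nat_card_alternatingGroup, Nat.card_eq_fintype_card, Fintype.card_fin]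
  rfl

/-- The members of the pencil with additional automorphisms are Wiman sextics. -/
lemma exists_eq_of_special [CharZero K] {ζ t γ : K} (hζ : IsPrimitiveRoot ζ 5) (ht : t ^ 5 = 3)
    (hγ : γ ≠ 0) (hw : (γ ^ 5) ^ 2 - 9 * γ ^ 5 + 864 = 0) : ∃ j : Fin 5,
      (12 - γ ^ 5) / γ ^ 2 = -15 * ζ ^ (-(j : ℕ) : ℤ) / t ^ 3 ∧
      (48 + γ ^ 5) / γ ^ 4 = -5 * ζ ^ (-(2 * (j : ℕ)) : ℤ) / t ∧
      (64 - 2 * γ ^ 5) / γ ^ 6 = (10 * t / 9) * ζ ^ (-(3 * (j : ℕ)) : ℤ) := by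
  have hζ0 : ζ ≠ 0 := hζ.ne_zero (by norm_num)
  have ht0 : t ≠ 0 := by rintro rfl; norm_num at ht
  have hu : (4 * (γ ^ 5 - 12) / (20 * t ^ 2 * γ ^ 2)) ^ 5 = 1 := by
    rw [div_pow, div_eq_one_iff_eq (by simp [ht0, hγ])]
    generalize hg : γ ^ 5 = g at hw
    have e : (20 * t ^ 2 * γ ^ 2) ^ 5 = 20 ^ 5 * (t ^ 5) ^ 2 * (γ ^ 5) ^ 2 := by ring
    rw [e, ht, hg]
    linear_combination (1024 * g ^ 3 - 52224 * g ^ 2 + 119808 * g - 294912) * hw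
  obtain ⟨j, hj⟩ := exists_fin_pow_eq hζ.inv hu
  rw [inv_pow] at hj
  set η := ζ ^ (j : ℕ) with hη
  have hη0 : η ≠ 0 := pow_ne_zero _ hζ0
  have z1 : ζ ^ (-(j : ℕ) : ℤ) = η⁻¹ := by rw [zpow_neg, zpow_natCast]
  have z2 : ζ ^ (-(2 * (j : ℕ)) : ℤ) = η⁻¹ ^ 2 := by
    rw [← z1, ← zpow_natCast, ← zpow_mul]; congr 1; push_cast; ring
  have z3 : ζ ^ (-(3 * (j : ℕ)) : ℤ) = η⁻¹ ^ 3 := by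
    rw [← z1, ← zpow_natCast, ← zpow_mul]; congr 1; push_cast; ring
  refine ⟨j, ?_⟩
  rw [z1, z2, z3, ← hj]
  generalize hg : γ ^ 5 = g at *
  refine ⟨?_, ?_, ?_⟩
  · field_simp
    linear_combination 20 * (12 - g) * ht
  · field_simp
    linear_combination 400 * (48 + g) * ht + 80 * hw
  · field_simp
    linear_combination 72000 * (64 - 2 * g) * ht - 640 * (g - 27) * hw

/-- With `√5 = s`, `t⁵ = 3`, and `γ ≠ 0` for which `C_γ` is smooth and avoids
the Wiman specializations, `Aut(C_γ)` is generated by `σ = diag(1, ζ₅, ζ₅⁻¹)`, `τ = [X:Z:Y]`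
and `τ′`, and is isomorphic to the alternating group `A₅`; in particular it has order `60`. -/
theorem gamma_sextic_automorphisms {K : Type*} [Field K] [IsAlgClosed K] [CharZero K]
    (ζ : K) (hζ : IsPrimitiveRoot ζ 5) (s : K) (hs : s ^ 2 = 5) (t : K) (ht : t ^ 5 = 3)
    (γ : K) (hγ : γ ≠ 0) (hsm : IsSmoothSextic (gammaSextic γ))
    (havoid : ∀ i j : Fin 5,
      ¬((12 - γ ^ 5) / γ ^ 2 = -15 * ζ ^ (-(3 * (i : ℕ) + (j : ℕ) : ℤ)) / t ^ 3 ∧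
        (48 + γ ^ 5) / γ ^ 4 = -5 * ζ ^ (-((i : ℕ) + 2 * (j : ℕ) : ℤ)) / t ∧
        (64 - 2 * γ ^ 5) / γ ^ 6 = (10 * t / 9) * ζ ^ (((i : ℕ) : ℤ) - 3 * ((j : ℕ) : ℤ)))) :
    planeAut (gammaSextic γ) = Subgroup.closure
      {pgl !![1, 0, 0; 0, ζ, 0; 0, 0, ζ⁻¹],
        pgl !![(1 : K), 0, 0; 0, 0, 1; 0, 1, 0],
        pgl !![1, 1, 1;
               2, (-1 + s) / 2, (-1 - s) / 2;
               2, (-1 - s) / 2, (-1 + s) / 2]} ∧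
    Nonempty (↥(planeAut (gammaSextic γ)) ≃* ↥(alternatingGroup (Fin 5))) ∧
    Nat.card ↥(planeAut (gammaSextic γ)) = 60 := by
  have hw : (γ ^ 5) ^ 2 - 9 * γ ^ 5 + 864 ≠ 0 := fun hw => by
    obtain ⟨j, h1, h2, h3⟩ := exists_eq_of_special hζ ht hγ hw
    exact havoid 0 j ⟨by simpa using h1, by simpa using h2, by simpa using h3⟩
  have hg : γ ^ 5 ≠ 0 := pow_ne_zero _ hγ
  obtain ⟨φ⟩ := nonempty_planeAut_mulEquiv hζ hs hg hw
  exact ⟨planeAut_pencil_eq_closure hζ hs hg hw, ⟨φ⟩,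
    (Nat.card_congr φ.toEquiv).trans card_alternatingGroup_five⟩
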